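/- Let y = {1, q, q², q³, ...} be the specialization y_i = q^{i-1}. Then for any partition μ of n, s_{μ'}(xy) = (-1)^n Σ_{τ ⊴ μ} 𝓗_τ(q) K̃_{μτ}(q) H̃_τ(x; q), where xy denotes the product alphabet {x_i q^{j-1}}, μ' the conjugate partition, τ ⊴ μ the dominance-closure order on unipotent types (τ in the closure of μ), 𝓗_τ(q) = 1/a_τ(q), K̃ the modified Kostka polynomial, and H̃_τ(x;q) = H̃_τ(x;q,0) the Hall–Littlewood specialization of the modified Macdonald polynomial. -/

import Mathlib

noncomputable section

open MvPolynomial Finset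

/-- the field `ℚ(q)` of coefficients -/
abbrev K : Type := RatFunc ℚ

/-- the indeterminate `q` -/
def q : K := RatFunc.X

/-- the ring of symmetric functions, presented as the polynomial ring on the power sums:
the variable `i` stands for `p_{i+1}` -/
abbrev SymF : Type := MvPolynomial ℕ K

/-- `p_ρ` -/
def pP {n : ℕ} (ρ : n.Partition) : SymF := (ρ.parts.map fun i => (X (i - 1) : SymF)).prod

/-- `z_ρ = Π_i i^{m_i} m_i!` -/
def zP {n : ℕ} (ρ : n.Partition) : ℕ :=
  ∏ i ∈ ρ.parts.toFinset, i ^ ρ.parts.count i * (ρ.parts.count i).factorial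

/-- the `z`-factor of a power-sum monomial -/
def zMon (d : ℕ →₀ ℕ) : K :=
  ∏ i ∈ d.support, (((i + 1) ^ d i * (d i).factorial : ℕ) : K)

/-- the Hall pairing, determined by `⟨p_λ, p_μ⟩ = δ_{λμ} z_λ` -/
def hall (f g : SymF) : K := ∑ d ∈ f.support, coeff d f * coeff d g * zMon d

/-- the complete homogeneous function `h_m = Σ_{ρ ⊢ m} z_ρ⁻¹ p_ρ` -/
def hP (m : ℕ) : SymF := ∑ ρ : m.Partition, ((zP ρ : K)⁻¹) • pP ρ

/-- `h_m` for `m : ℤ`, vanishing for `m < 0` -/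
def hZ (m : ℤ) : SymF := if m < 0 then 0 else hP m.toNat

/-- the parts of a partition, as a weakly decreasing list -/
def sortedParts {n : ℕ} (lam : n.Partition) : List ℕ := (lam.parts.sort (· ≤ ·)).reverse

/-- the Schur function `s_λ`, via the Jacobi–Trudi determinant
`s_λ = det(h_{λ_i - i + j})` -/
def schur {n : ℕ} (lam : n.Partition) : SymF :=
  Matrix.det (Matrix.of fun i j : Fin (sortedParts lam).length =>
    hZ (((sortedParts lam).get i : ℤ) - (i : ℤ) + (j : ℤ)))

/-- the character value `χ^μ_ρ` of the symmetric group, via the Frobenius characteristic: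
`χ^μ_ρ = ⟨s_μ, p_ρ⟩` -/
def chiS {n : ℕ} (μ ρ : n.Partition) : K := hall (schur μ) (pP ρ)

/-- `n(λ) = Σ (i-1) λ_i` -/
def nStat {n : ℕ} (lam : n.Partition) : ℕ :=
  ∑ i ∈ Finset.range (sortedParts lam).length, i * (sortedParts lam).getD i 0

/-- `a_λ(q)`, the order of the centralizer in `GL_n(F_q)` of a unipotent element of Jordan
type `λ`: `a_λ(q) = q^{|λ| + 2n(λ)} Π_i Π_{k=1}^{m_i} (1 - q^{-k})` -/
def aP {n : ℕ} (lam : n.Partition) : K :=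
  q ^ (n + 2 * nStat lam) *
    ∏ i ∈ lam.parts.toFinset, ∏ k ∈ Finset.range (lam.parts.count i), (1 - q⁻¹ ^ (k + 1))

/-- `𝓗_λ(q) = 1 / a_λ(q)` -/
def HsH {n : ℕ} (lam : n.Partition) : K := (aP lam)⁻¹

/-- the Hall–Littlewood deformed `z`-factor of a power-sum monomial:
`z_λ(t) = z_λ Π_i (1 - t^{λ_i})⁻¹` with `t = q` -/
def zMonT (d : ℕ →₀ ℕ) : K := zMon d * ∏ i ∈ d.support, ((1 - q ^ (i + 1))⁻¹) ^ d i

/-- the `t = q` deformed Hall pairing `⟨p_λ, p_μ⟩_q = δ_{λμ} z_λ Π_i (1-q^{λ_i})⁻¹` -/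
def hallT (f g : SymF) : K := ∑ d ∈ f.support, coeff d f * coeff d g * zMonT d

/-- `h_λ = h_{λ_1} h_{λ_2} ⋯` (the basis dual to the monomial basis: the coefficient of
`m_μ` in a symmetric function `f` is `⟨f, h_μ⟩`) -/
def hProd {n : ℕ} (lam : n.Partition) : SymF := (lam.parts.map fun i => hP i).prod

/-- dominance order on partitions -/
def dominates {n : ℕ} (μ lam : n.Partition) : Prop :=
  ∀ k, ((sortedParts μ).take k).sum ≤ ((sortedParts lam).take k).sum

/-- the defining properties of the Hall–Littlewood symmetric functions `P_λ(x; q)`: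
degree `n` homogeneity, unitriangularity `P_λ = m_λ + Σ_{μ < λ} c_{λμ} m_μ` with respect to
dominance order, and orthogonality for the `t = q` deformed Hall pairing. -/
structure IsHLBasis (n : ℕ) (P : n.Partition → SymF) : Prop where
  homog : ∀ lam, (P lam).IsWeightedHomogeneous (fun i => i + 1) n
  triangular : ∀ lam μ, hall (P lam) (hProd μ) ≠ 0 → dominates μ lam
  diag : ∀ lam, hall (P lam) (hProd lam) = 1
  orth : ∀ lam μ, lam ≠ μ → hallT (P lam) (P μ) = 0

/-- the modified Kostka–Foulkes polynomials `K̃_{μλ}(q) = q^{n(λ)} K_{μλ}(q⁻¹)`, given the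
Kostka–Foulkes coefficients `Kst` (defined by `s_μ = Σ_λ K_{μλ}(q) P_λ(x;q)`) and the
automorphism `invq : q ↦ q⁻¹` of `ℚ(q)` -/
def Ktilde {n : ℕ} (Kst : n.Partition → n.Partition → K) (invq : K →+* K)
    (μ lam : n.Partition) : K :=
  q ^ nStat lam * invq (Kst μ lam)

/-- `y_ρ(q) = q^{-|ρ|} z_ρ Π_i (1 - q^{-ρ_i})⁻¹` -/
def yP {n : ℕ} (ρ : n.Partition) : K :=
  q⁻¹ ^ n * (zP ρ : K) * (ρ.parts.map fun i => ((1 : K) - q⁻¹ ^ i)⁻¹).prod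

/-!
STATEMENT 9: With the specialization `y = {1, q, q², …}` (so that `p_r(y) = (1-q^r)⁻¹`), for any
partition `μ` of `n`:
`s_{μ'}(xy) = (-1)^n Σ_{τ ⊴ μ} 𝓗_τ(q) K̃_{μτ}(q) H̃_τ(x;q)`,
where `xy` is the product alphabet (the algebra map `p_r ↦ p_r(y)·p_r`), `μ'` the conjugate
partition, `τ ⊴ μ` the dominance (closure) order, `𝓗_τ(q) = 1/a_τ(q)`, `K̃` the modified
Kostka–Foulkes polynomials (entering through the Kostka–Foulkes coefficients
`s_μ = Σ_λ K_{μλ}(q) P_λ(x;q)` for the Hall–Littlewood basis `P`), and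
`H̃_τ(x;q) = Σ_ν K̃_{ντ}(q) s_ν(x)` the modified Hall–Littlewood functions.
-/

/-- multiplication of the alphabet by `y = {1, q, q², …}`: the algebra map
`p_r ↦ (1-q^r)⁻¹ p_r` -/
def mulY : SymF →ₐ[K] SymF :=
  MvPolynomial.aeval fun i => ((1 : K) - q ^ (i + 1))⁻¹ • (X i : SymF)

/-- the modified Hall–Littlewood function `H̃_τ(x;q) = Σ_ν K̃_{ντ}(q) s_ν(x)` -/
def Htilde {n : ℕ} (Kst : n.Partition → n.Partition → K) (invq : K →+* K)
    (τ : n.Partition) : SymF :=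
  ∑ ν : n.Partition, Ktilde Kst invq ν τ • schur ν

/-! ### The Hall pairing -/

theorem zMon_ne_zero (d : ℕ →₀ ℕ) : zMon d ≠ 0 := by
  refine Finset.prod_ne_zero_iff.2 fun i _ => Nat.cast_ne_zero.2 ?_
  positivity

theorem zMon_add_single (d : ℕ →₀ ℕ) (i : ℕ) :
    zMon (d + Finsupp.single i 1) = ((i + 1 : ℕ) : K) * ((d i + 1 : ℕ) : K) * zMon d := by
  classical
  have key : ∀ e : ℕ →₀ ℕ, ∀ s : Finset ℕ, e.support ⊆ s →
      zMon e = ∏ j ∈ s, (((j + 1) ^ e j * (e j).factorial : ℕ) : K) := by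
    intro e s hs
    refine Finset.prod_subset hs fun j _ hj => ?_
    rw [Finsupp.notMem_support_iff.1 hj]
    simp
  have h1 : d.support ⊆ insert i d.support := Finset.subset_insert _ _
  have h2 : (d + Finsupp.single i 1).support ⊆ insert i d.support := by
    intro j hj
    by_cases hji : j = i
    · simp [hji]
    · rw [Finsupp.mem_support_iff] at hj
      simp only [Finsupp.add_apply, Finsupp.single_apply, if_neg (Ne.symm hji), add_zero] at hj
      simp [hj]
  rw [key _ _ h1, key _ _ h2, ← Finset.mul_prod_erase _ _ (Finset.mem_insert_self i _),
    ← Finset.mul_prod_erase (insert i d.support) (fun j => (((j + 1) ^ d j * (d j).factorial : ℕ) : K))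
      (Finset.mem_insert_self i _), ← mul_assoc]
  congr 1
  · simp only [Finsupp.add_apply, Finsupp.single_eq_same, pow_succ, Nat.factorial_succ]
    push_cast
    ring
  · refine Finset.prod_congr rfl fun j hj => ?_
    simp [(Finset.ne_of_mem_erase hj).symm]

theorem hall_eq_sum (f g : SymF) (s : Finset (ℕ →₀ ℕ)) (hs : f.support ⊆ s) :
    hall f g = ∑ d ∈ s, coeff d f * coeff d g * zMon d := by
  refine Finset.sum_subset hs fun d _ hd => ?_
  rw [notMem_support_iff.1 hd]
  simp

theorem hall_add_left (f f' g : SymF) : hall (f + f') g = hall f g + hall f' g := by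
  classical
  rw [hall_eq_sum f g (f.support ∪ f'.support) Finset.subset_union_left,
    hall_eq_sum f' g (f.support ∪ f'.support) Finset.subset_union_right,
    hall_eq_sum (f + f') g (f.support ∪ f'.support) support_add, ← Finset.sum_add_distrib]
  refine Finset.sum_congr rfl fun d _ => ?_
  rw [coeff_add]
  ring

theorem hall_smul_left (c : K) (f g : SymF) : hall (c • f) g = c * hall f g := by
  rw [hall_eq_sum (c • f) g f.support support_smul, hall, Finset.mul_sum]
  refine Finset.sum_congr rfl fun d _ => ?_
  rw [coeff_smul, smul_eq_mul]
  ring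

theorem hall_comm (f g : SymF) : hall f g = hall g f := by
  classical
  rw [hall_eq_sum f g (f.support ∪ g.support) Finset.subset_union_left,
    hall_eq_sum g f (f.support ∪ g.support) Finset.subset_union_right]
  refine Finset.sum_congr rfl fun d _ => ?_
  ring

/-- the Hall pairing as a bilinear form -/
def hallB : SymF →ₗ[K] SymF →ₗ[K] K :=
  LinearMap.mk₂ K hall hall_add_left hall_smul_left
    (fun f g g' => by rw [hall_comm, hall_add_left, hall_comm g, hall_comm g'])
    (fun c f g => by rw [hall_comm, hall_smul_left, hall_comm g]; rfl)

theorem hallB_apply (f g : SymF) : hallB f g = hall f g := rfl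

theorem hall_add_right (f g g' : SymF) : hall f (g + g') = hall f g + hall f g' :=
  map_add (hallB f) g g'

theorem hall_smul_right (c : K) (f g : SymF) : hall f (c • g) = c * hall f g :=
  map_smul (hallB f) c g

theorem hall_zero_left (g : SymF) : hall 0 g = 0 := by simp [hall]

theorem hall_sum_left {ι : Type*} (s : Finset ι) (f : ι → SymF) (g : SymF) :
    hall (∑ i ∈ s, f i) g = ∑ i ∈ s, hall (f i) g := by
  rw [← hallB_apply, map_sum, LinearMap.sum_apply]
  rfl

theorem hall_sum_right {ι : Type*} (s : Finset ι) (f : SymF) (g : ι → SymF) :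
    hall f (∑ i ∈ s, g i) = ∑ i ∈ s, hall f (g i) := map_sum (hallB f) g s

theorem hall_monomial_left (d : ℕ →₀ ℕ) (a : K) (g : SymF) :
    hall (monomial d a) g = a * coeff d g * zMon d := by
  classical
  rw [hall_eq_sum _ g {d} support_monomial_subset, Finset.sum_singleton, coeff_monomial, if_pos rfl]

theorem hall_monomial_right (d : ℕ →₀ ℕ) (a : K) (f : SymF) :
    hall f (monomial d a) = a * coeff d f * zMon d := by
  rw [hall_comm, hall_monomial_left]

theorem hall_one_left (g : SymF) : hall 1 g = coeff 0 g := by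
  rw [← C_1, C_apply, hall_monomial_left]
  simp [zMon]

theorem eq_zero_of_hall_eq_zero (f : SymF) (h : ∀ g, hall f g = 0) : f = 0 := by
  ext d
  have := h (monomial d 1)
  rw [hall_monomial_right, one_mul] at this
  simpa [zMon_ne_zero] using this

theorem eq_of_hall_eq (f f' : SymF) (h : ∀ g, hall g f = hall g f') : f = f' := by
  rw [← sub_eq_zero]
  refine eq_zero_of_hall_eq_zero _ fun g => ?_
  rw [hall_comm, ← hallB_apply, map_sub, hallB_apply, hallB_apply, h, sub_self]

theorem hall_X_mul (i : ℕ) (f g : SymF) :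
    hall (X i * f) g = ((i + 1 : ℕ) : K) * hall f (pderiv i g) := by
  induction f using MvPolynomial.induction_on' with
  | monomial d a =>
    rw [mul_comm, X, monomial_mul, hall_monomial_left, hall_monomial_left, zMon_add_single,
      coeff_pderiv]
    push_cast
    ring
  | add f f' h h' => rw [mul_add, hall_add_left, hall_add_left, mul_add, h, h']

/-! ### Complete homogeneous functions -/

/-- the exponent vector of the power-sum monomial `p_ρ` -/
def expo {n : ℕ} (ρ : n.Partition) : ℕ →₀ ℕ := Multiset.toFinsupp (ρ.parts.map fun i => i - 1)

theorem expo_apply {n : ℕ} (ρ : n.Partition) (i : ℕ) : expo ρ i = ρ.parts.count (i + 1) := by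
  classical
  rw [expo, Multiset.toFinsupp_apply, Multiset.count_map, Multiset.count, Multiset.countP_eq_card_filter]
  congr 1
  refine Multiset.filter_congr fun j hj => ?_
  have := ρ.parts_pos hj
  omega

theorem pP_eq_monomial {n : ℕ} (ρ : n.Partition) : pP ρ = monomial (expo ρ) 1 := by
  have : ∀ s : Multiset ℕ, (s.map fun i => (X (i - 1) : SymF)).prod
      = monomial (Multiset.toFinsupp (s.map fun i => i - 1)) 1 := by
    intro s
    induction s using Multiset.induction_on with
    | empty => simp
    | cons a s ih =>
      rw [Multiset.map_cons, Multiset.prod_cons, ih, Multiset.map_cons, ← Multiset.singleton_add,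
        map_add, Multiset.toFinsupp_singleton, X, monomial_mul, one_mul]
  exact this _

theorem zMon_expo {n : ℕ} (ρ : n.Partition) : zMon (expo ρ) = (zP ρ : K) := by
  rw [zMon, zP, Nat.cast_prod]
  refine Finset.prod_bij (fun i _ => i + 1) ?_ ?_ ?_ ?_
  · intro i hi
    rw [Finsupp.mem_support_iff, expo_apply] at hi
    exact Multiset.mem_toFinset.2 (Multiset.count_ne_zero.1 hi)
  · intro i _ j _ h
    omega
  · intro j hj
    rw [Multiset.mem_toFinset] at hj
    have := ρ.parts_pos hj
    refine ⟨j - 1, ?_, by omega⟩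
    rw [Finsupp.mem_support_iff, expo_apply, Nat.sub_add_cancel this]
    exact Multiset.count_ne_zero.2 hj
  · intro i _
    rw [expo_apply]

/-- the weight of a power-sum monomial, `p_r` having weight `r` -/
abbrev wt : (ℕ →₀ ℕ) →+ ℕ := Finsupp.weight fun i : ℕ => i + 1

theorem wt_toFinsupp (s : Multiset ℕ) :
    wt (Multiset.toFinsupp s) = (s.map fun i => i + 1).sum := by
  induction s using Multiset.induction_on with
  | empty => simp
  | cons a s ih =>
    rw [← Multiset.singleton_add, map_add, map_add, ih, Multiset.toFinsupp_singleton,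
      Finsupp.weight_single]
    simp

theorem wt_expo {n : ℕ} (ρ : n.Partition) : wt (expo ρ) = n := by
  rw [expo, wt_toFinsupp, Multiset.map_map]
  conv_rhs => rw [← ρ.parts_sum]
  congr 1
  conv_rhs => rw [← Multiset.map_id ρ.parts]
  refine Multiset.map_congr rfl fun i hi => ?_
  have := ρ.parts_pos hi
  simp only [Function.comp, id]
  omega

theorem expo_injective {n : ℕ} : Function.Injective (expo (n := n)) := by
  intro ρ σ h
  refine Nat.Partition.ext (Multiset.ext.2 fun i => ?_)
  rcases i with _ | i
  · rw [Multiset.count_eq_zero_of_notMem fun h0 => (ρ.parts_pos h0).ne rfl,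
      Multiset.count_eq_zero_of_notMem fun h0 => (σ.parts_pos h0).ne rfl]
  · rw [← expo_apply, ← expo_apply, h]

theorem exists_expo_eq (d : ℕ →₀ ℕ) : ∃ ρ : (wt d).Partition, expo ρ = d := by
  refine ⟨⟨(Finsupp.toMultiset d).map fun i => i + 1, ?_, ?_⟩, ?_⟩
  · intro i hi
    obtain ⟨j, -, rfl⟩ := Multiset.mem_map.1 hi
    omega
  · rw [← wt_toFinsupp, Finsupp.toMultiset_toFinsupp]
  · rw [expo]
    simp only [Multiset.map_map, Function.comp_def, Nat.add_sub_cancel, Multiset.map_id']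
    exact Finsupp.toMultiset_toFinsupp d

theorem coeff_hP (k : ℕ) (d : ℕ →₀ ℕ) :
    coeff d (hP k) = if wt d = k then (zMon d)⁻¹ else 0 := by
  classical
  simp only [hP, coeff_sum, coeff_smul, pP_eq_monomial, coeff_monomial, smul_eq_mul, mul_ite,
    mul_one, mul_zero]
  split_ifs with h
  · subst h
    obtain ⟨ρ, hρ⟩ := exists_expo_eq d
    rw [Finset.sum_eq_single ρ, if_pos hρ, ← zMon_expo, hρ]
    · intro σ _ hσ
      refine if_neg fun h => hσ (expo_injective (h.trans hρ.symm))
    · simp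
  · refine Finset.sum_eq_zero fun ρ _ => if_neg fun hρ => h ?_
    rw [← hρ, wt_expo]

theorem hP_zero : hP 0 = 1 := by
  classical
  ext d
  rw [coeff_hP, coeff_one]
  by_cases h : d = 0
  · subst h
    simp [zMon]
  · rw [if_neg (Ne.symm h), if_neg]
    intro h'
    refine h (Finsupp.ext fun i => ?_)
    by_contra hi
    have := Finsupp.le_weight (fun i : ℕ => i + 1) (s := i) (by simp) d
    simp only [Finsupp.coe_zero, Pi.zero_apply] at hi
    change Finsupp.weight (fun i : ℕ => i + 1) d = 0 at h'
    omega

theorem hP_homogeneous (k : ℕ) : (hP k).IsWeightedHomogeneous (fun i => i + 1) k := by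
  intro d hd
  rw [coeff_hP] at hd
  by_contra h
  exact hd (if_neg h)

/-- Newton's identity for the complete homogeneous functions -/
theorem newton_hP (n : ℕ) :
    ((n + 1 : ℕ) : SymF) * hP (n + 1) = ∑ ij ∈ antidiagonal n, X ij.1 * hP ij.2 := by
  classical
  ext d
  have h0 : ((n + 1 : ℕ) : SymF) = C ((n + 1 : ℕ) : K) := by simp
  rw [h0, coeff_C_mul, coeff_hP, coeff_sum]
  have hterm : ∀ ij ∈ antidiagonal n, coeff d (X ij.1 * hP ij.2)
      = if wt d = n + 1 then (((ij.1 + 1) * d ij.1 : ℕ) : K) * (zMon d)⁻¹ else 0 := by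
    intro ij hij
    rw [HasAntidiagonal.mem_antidiagonal] at hij
    rw [coeff_X_mul']
    by_cases hi : ij.1 ∈ d.support
    · have hi' : d ij.1 ≠ 0 := Finsupp.mem_support_iff.1 hi
      rw [if_pos hi, coeff_hP]
      have hw := Finsupp.weight_sub_single_add (w := fun i : ℕ => i + 1) hi'
      have hd : d - Finsupp.single ij.1 1 + Finsupp.single ij.1 1 = d :=
        Finsupp.sub_add_single_one_cancel hi'
      have hz := zMon_add_single (d - Finsupp.single ij.1 1) ij.1
      rw [hd] at hz
      have hdi : (d - Finsupp.single ij.1 1 : ℕ →₀ ℕ) ij.1 + 1 = d ij.1 := by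
        simp only [Finsupp.coe_tsub, Pi.sub_apply, Finsupp.single_eq_same]
        omega
      rw [hdi] at hz
      by_cases hn : wt d = n + 1
      · rw [if_pos hn, if_pos (by simp only [wt] at hn ⊢; omega), hz]
        have h1 : ((ij.1 + 1 : ℕ) : K) ≠ 0 := Nat.cast_ne_zero.2 (by omega)
        have h2 : ((d ij.1 : ℕ) : K) ≠ 0 := Nat.cast_ne_zero.2 hi'
        have h3 := zMon_ne_zero (d - Finsupp.single ij.1 1)
        rw [Nat.cast_mul]
        field_simp
      · rw [if_neg hn, if_neg (by simp only [wt] at hn ⊢; omega)]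
    · rw [if_neg hi, Finsupp.notMem_support_iff.1 hi]
      simp
  rw [Finset.sum_congr rfl hterm]
  split_ifs with hn
  · rw [← Finset.sum_mul, ← Nat.cast_sum]
    congr 2
    rw [Finset.Nat.sum_antidiagonal_eq_sum_range_succ_mk, ← hn, wt, Finsupp.weight_apply,
      Finsupp.sum]
    refine (Finset.sum_subset_zero_on_sdiff (fun i hi => ?_) ?_ ?_)
    · have := Finsupp.le_weight_of_ne_zero' (fun i : ℕ => i + 1) (Finsupp.mem_support_iff.1 hi)
      rw [Finset.mem_range]
      change Finsupp.weight (fun i : ℕ => i + 1) d = n + 1 at hn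
      omega
    · intro i hi
      rw [Finset.mem_sdiff, Finsupp.notMem_support_iff] at hi
      simp [hi.2]
    · intro i _
      simp [mul_comm]
  · simp

/-! ### Rescaled power sums and skewing operators -/

/-- the algebra map `p_{i+1} ↦ c_i p_{i+1}` -/
def scal (c : ℕ → K) : SymF →ₐ[K] SymF := aeval fun i => c i • (X i : SymF)

theorem scal_X (c : ℕ → K) (i : ℕ) : scal c (X i) = c i • X i := aeval_X _ _

theorem scal_monomial (c : ℕ → K) (d : ℕ →₀ ℕ) (a : K) :
    scal c (monomial d a) = (d.prod fun i m => c i ^ m) • monomial d a := by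
  rw [scal, aeval_monomial]
  have : (d.prod fun i k => (c i • (X i : SymF)) ^ k)
      = C (d.prod fun i m => c i ^ m) * d.prod fun i k => (X i : SymF) ^ k := by
    simp only [Finsupp.prod, map_prod, ← Finset.prod_mul_distrib, smul_eq_C_mul, mul_pow, map_pow]
  rw [this, smul_eq_C_mul, monomial_eq, algebraMap_eq]
  ring

theorem coeff_scal (c : ℕ → K) (d : ℕ →₀ ℕ) (f : SymF) :
    coeff d (scal c f) = (d.prod fun i m => c i ^ m) * coeff d f := by
  classical
  induction f using MvPolynomial.induction_on' with
  | monomial e a =>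
    rw [scal_monomial, coeff_smul, coeff_monomial]
    split_ifs with h
    · rw [h, smul_eq_mul]
    · simp
  | add f f' h h' => rw [map_add, coeff_add, coeff_add, h, h', mul_add]

theorem scal_one (f : SymF) : scal (fun _ => 1) f = f := by
  ext d
  simp [coeff_scal, Finsupp.prod]

theorem scal_scal (c c' : ℕ → K) (f : SymF) :
    scal c (scal c' f) = scal (fun i => c i * c' i) f := by
  ext d
  simp only [coeff_scal, Finsupp.prod, mul_pow, Finset.prod_mul_distrib]
  ring

theorem hall_scal (c : ℕ → K) (f g : SymF) : hall (scal c f) g = hall f (scal c g) := by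
  classical
  rw [hall_eq_sum (scal c f) g f.support, hall]
  · refine Finset.sum_congr rfl fun d _ => ?_
    rw [coeff_scal, coeff_scal]
    ring
  · intro d hd
    rw [mem_support_iff, coeff_scal] at hd
    exact mem_support_iff.2 (right_ne_zero_of_mul hd)

/-- the algebra map `p_{i+1} ↦ p_{i+1} + g_i T^{i+1}` -/
def Gam (g : ℕ → K) : SymF →ₐ[K] Polynomial SymF :=
  aeval fun i => Polynomial.C (X i) + Polynomial.monomial (i + 1) (C (g i))

theorem Gam_X (g : ℕ → K) (i : ℕ) :
    Gam g (X i) = Polynomial.C (X i) + Polynomial.monomial (i + 1) (C (g i)) := aeval_X _ _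

theorem Gam_C (g : ℕ → K) (a : K) : Gam g (C a) = Polynomial.C (C a) := by
  rw [Gam, aeval_C]
  rfl

/-- the coefficient of `T^k` in `Gam g f` -/
def skew (g : ℕ → K) (k : ℕ) : SymF →ₗ[K] SymF :=
  ((Polynomial.lcoeff SymF k).restrictScalars K).comp (Gam g).toLinearMap

theorem skew_apply (g : ℕ → K) (k : ℕ) (f : SymF) : skew g k f = (Gam g f).coeff k := rfl

theorem skew_mul (g : ℕ → K) (k : ℕ) (f f' : SymF) :
    skew g k (f * f') = ∑ ij ∈ antidiagonal k, skew g ij.1 f * skew g ij.2 f' := by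
  simp only [skew_apply, map_mul, Polynomial.coeff_mul]

theorem skew_C (g : ℕ → K) (k : ℕ) (a : K) : skew g k (C a) = if k = 0 then C a else 0 := by
  rw [skew_apply, Gam_C, Polynomial.coeff_C]

theorem skew_mul_X (g : ℕ → K) (k : ℕ) (f : SymF) (i : ℕ) :
    skew g k (f * X i)
      = skew g k f * X i + if i + 1 ≤ k then g i • skew g (k - (i + 1)) f else 0 := by
  rw [skew_apply, map_mul, Gam_X, mul_add, Polynomial.coeff_add, Polynomial.coeff_mul_C,
    ← Polynomial.C_mul_X_pow_eq_monomial, ← mul_assoc, Polynomial.coeff_mul_X_pow']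
  simp only [Polynomial.coeff_mul_C, skew_apply, smul_eq_C_mul, mul_comm]

theorem skew_pderiv (g : ℕ → K) (k i : ℕ) (f : SymF) :
    skew g k (pderiv i f) = pderiv i (skew g k f) := by
  classical
  induction f using MvPolynomial.induction_on generalizing k with
  | C a =>
    rw [pderiv_C, map_zero, skew_C]
    split_ifs <;> simp
  | add f f' h h' => simp only [map_add, h, h']
  | mul_X f j h =>
    rw [skew_mul_X, Derivation.leibniz, pderiv_X, map_add, smul_eq_mul, smul_eq_mul, map_add,
      Derivation.leibniz, pderiv_X, mul_comm (X j), skew_mul_X, h]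
    have h1 : skew g k (f * (Pi.single i 1 : ℕ → SymF) j)
        = skew g k f * (Pi.single i 1 : ℕ → SymF) j := by
      by_cases hj : j = i
      · subst hj
        simp
      · simp [hj]
    rw [h1]
    have h2 : pderiv i (if j + 1 ≤ k then g j • skew g (k - (j + 1)) f else 0)
        = if j + 1 ≤ k then g j • skew g (k - (j + 1)) (pderiv i f) else 0 := by
      split_ifs with hk
      · rw [Derivation.map_smul, h]
      · simp
    rw [h2, smul_eq_mul, smul_eq_mul]
    ring

theorem coeff_zero_skew_monomial (c : ℕ → K) (k : ℕ) (d : ℕ →₀ ℕ) (a : K) :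
    coeff 0 (skew c k (monomial d a))
      = if wt d = k then a * d.prod fun i m => c i ^ m else 0 := by
  have h : ∀ f : SymF, Polynomial.map (constantCoeff (σ := ℕ) (R := K)) (Gam c f)
      = aeval (fun i => Polynomial.monomial (i + 1) (c i)) f := by
    intro f
    have : (Polynomial.mapRingHom (constantCoeff (σ := ℕ) (R := K))).comp (Gam c).toRingHom
        = (aeval (fun i => Polynomial.monomial (i + 1) (c i)) : SymF →ₐ[K] Polynomial K).toRingHom := by
      refine MvPolynomial.ringHom_ext (fun a => ?_) fun i => ?_
      · simp
      · simp [Gam_X]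
    exact RingHom.congr_fun this f
  have h2 := congrArg (fun p => Polynomial.coeff p k) (h (monomial d a))
  simp only [Polynomial.coeff_map, constantCoeff_eq] at h2
  rw [skew_apply, h2, aeval_monomial]
  have h3 : (d.prod fun i m => (Polynomial.monomial (i + 1) (c i) : Polynomial K) ^ m)
      = Polynomial.monomial (wt d) (d.prod fun i m => c i ^ m) := by
    clear h2
    induction d using Finsupp.induction_linear with
    | zero => simp
    | add d e hd he =>
      rw [Finsupp.prod_add_index' (by simp) (by intros; rw [pow_add]), hd, he,
        Finsupp.prod_add_index' (by simp) (by intros; rw [pow_add]), map_add,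
        Polynomial.monomial_mul_monomial]
    | single i m =>
      rw [Finsupp.prod_single_index (by simp), Finsupp.prod_single_index (by simp),
        Polynomial.monomial_pow, wt, Finsupp.weight_single, smul_eq_mul, mul_comm]
  rw [h3, Polynomial.algebraMap_eq, Polynomial.C_mul_monomial, Polynomial.coeff_monomial]

/-- `skew c k` is adjoint to multiplication by `h_k` with power sums rescaled by `c` -/
theorem hall_scal_hP_mul (c : ℕ → K) (k : ℕ) (f g : SymF) :
    hall (scal c (hP k) * f) g = hall f (skew c k g) := by
  induction f using MvPolynomial.induction_on generalizing g with
  | C a =>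
    rw [mul_comm, ← smul_eq_C_mul, hall_smul_left, C_eq_smul_one, hall_smul_left, hall_one_left]
    congr 1
    induction g using MvPolynomial.induction_on' with
    | monomial d b =>
      rw [hall_monomial_right, coeff_scal, coeff_hP, coeff_zero_skew_monomial]
      split_ifs
      · field_simp [zMon_ne_zero d]
      · simp
    | add g g' h h' => rw [hall_add_right, map_add, coeff_add, h, h']
  | add f f' h h' => rw [mul_add, hall_add_left, hall_add_left, h, h']
  | mul_X f i h =>
    rw [← mul_assoc, mul_comm _ (X i), hall_X_mul, h, skew_pderiv, mul_comm f, hall_X_mul]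

theorem hall_skew (c : ℕ → K) (k : ℕ) (f g : SymF) :
    hall (skew c k f) g = hall f (scal c (hP k) * g) := by
  rw [hall_comm, ← hall_scal_hP_mul, hall_comm]

theorem skew_comm (g g' : ℕ → K) (k j : ℕ) (f : SymF) :
    skew g k (skew g' j f) = skew g' j (skew g k f) := by
  refine eq_of_hall_eq _ _ fun u => ?_
  rw [← hall_scal_hP_mul, ← hall_scal_hP_mul, ← hall_scal_hP_mul, ← hall_scal_hP_mul,
    mul_left_comm]

/-! ### Logarithmic derivatives of generating series -/

/-- `A = exp(Σ_i p_i u^{i+1} / (i+1))`, expressed by a differential equation -/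
def IsExpSeries {R : Type*} [CommRing R] (A : PowerSeries R) (p : ℕ → R) : Prop :=
  PowerSeries.constantCoeff A = 1 ∧
    PowerSeries.derivative R A = PowerSeries.mk p * A

namespace IsExpSeries

variable {R S : Type*} [CommRing R] [CommRing S]

theorem coeff_succ {A : PowerSeries R} {p : ℕ → R} (h : IsExpSeries A p) (n : ℕ) :
    PowerSeries.coeff (n + 1) A * ((n : R) + 1)
      = ∑ ij ∈ antidiagonal n, p ij.1 * PowerSeries.coeff ij.2 A := by
  have := congrArg (PowerSeries.coeff n) h.2
  simpa only [PowerSeries.coeff_derivative, PowerSeries.coeff_mul, PowerSeries.coeff_mk] using this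

theorem of_coeff {A : PowerSeries R} {p : ℕ → R} (h0 : PowerSeries.coeff 0 A = 1)
    (h : ∀ n, PowerSeries.coeff (n + 1) A * ((n : R) + 1)
      = ∑ ij ∈ antidiagonal n, p ij.1 * PowerSeries.coeff ij.2 A) : IsExpSeries A p := by
  refine ⟨by simpa using h0, PowerSeries.ext fun n => ?_⟩
  rw [PowerSeries.coeff_derivative, PowerSeries.coeff_mul, h]
  simp

theorem unique [IsDomain R] [CharZero R] {A B : PowerSeries R} {p : ℕ → R}
    (hA : IsExpSeries A p) (hB : IsExpSeries B p) : A = B := by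
  ext n
  induction n using Nat.strong_induction_on with
  | _ n ih =>
    rcases n with _ | n
    · simpa using hA.1.trans hB.1.symm
    · have h1 : ((n : R) + 1) ≠ 0 := by exact_mod_cast Nat.succ_ne_zero n
      refine mul_right_cancel₀ h1 ?_
      rw [hA.coeff_succ, hB.coeff_succ]
      refine Finset.sum_congr rfl fun ij hij => ?_
      rw [HasAntidiagonal.mem_antidiagonal] at hij
      rw [ih _ (by omega)]

theorem mul {A B : PowerSeries R} {p r : ℕ → R} (hA : IsExpSeries A p) (hB : IsExpSeries B r) :
    IsExpSeries (A * B) (fun i => p i + r i) := by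
  refine ⟨by simp [hA.1, hB.1], ?_⟩
  have : (PowerSeries.mk fun i => p i + r i) = PowerSeries.mk p + PowerSeries.mk r := by
    ext
    simp
  rw [Derivation.leibniz, hA.2, hB.2, this, smul_eq_mul, smul_eq_mul]
  ring

theorem map {A : PowerSeries R} {p : ℕ → R} (hA : IsExpSeries A p) (φ : R →+* S) :
    IsExpSeries (PowerSeries.map φ A) (fun i => φ (p i)) := by
  refine of_coeff ?_ fun n => ?_
  · have := hA.1
    simp [this]
  · have := congrArg φ (hA.coeff_succ n)
    simpa using this

theorem geometric (c : R) : IsExpSeries (PowerSeries.mk fun n => c ^ n) (fun i => c ^ (i + 1)) := by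
  refine of_coeff (by simp) fun n => ?_
  simp only [PowerSeries.coeff_mk]
  rw [Finset.sum_congr rfl (g := fun _ => c ^ (n + 1))]
  · simp
    ring
  · intro ij hij
    rw [HasAntidiagonal.mem_antidiagonal] at hij
    rw [← pow_add]
    congr 1
    omega

theorem one_sub_mul_X (c : R) : IsExpSeries (1 - PowerSeries.C c * PowerSeries.X)
    (fun i => - c ^ (i + 1)) := by
  refine ⟨by simp, ?_⟩
  have h : (PowerSeries.mk fun i => - c ^ (i + 1)) * (1 - PowerSeries.C c * PowerSeries.X)
      = - PowerSeries.C c := by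
    ext n
    rw [mul_sub, mul_one, mul_comm (PowerSeries.C c), ← mul_assoc, map_sub,
      PowerSeries.coeff_mul_C]
    rcases n with _ | n
    · simp
    · rw [PowerSeries.coeff_succ_mul_X]
      simp [pow_succ]
  rw [h]
  simp [PowerSeries.derivative_C]

end IsExpSeries

/-! ### Skewing complete homogeneous functions -/

theorem isExpSeries_hP : IsExpSeries (PowerSeries.mk hP) (fun i => (X i : SymF)) := by
  refine .of_coeff (by simp [hP_zero]) fun n => ?_
  have := newton_hP n
  push_cast at this
  simpa [mul_comm] using this

theorem skew_scal_hP {c g : ℕ → K} {κ : PowerSeries K} (hκ : IsExpSeries κ fun i => c i * g i)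
    (k n : ℕ) :
    skew g k (scal c (hP n))
      = if k ≤ n then PowerSeries.coeff k κ • scal c (hP (n - k)) else 0 := by
  have hS : IsExpSeries (PowerSeries.mk fun n => scal c (hP n)) fun i => c i • (X i : SymF) := by
    have := isExpSeries_hP.map (scal c).toRingHom
    convert this using 1
    · ext1 n
      simp
    · funext i
      exact (scal_X c i).symm
  have hG : IsExpSeries (PowerSeries.mk fun n => Gam g (scal c (hP n)))
      fun i => c i • (Polynomial.C (X i) + Polynomial.monomial (i + 1) (C (g i))) := by
    have := hS.map (Gam g).toRingHom
    convert this using 1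
    · ext1 n
      simp
    · funext i
      exact ((map_smul (Gam g) (c i) (X i)).trans (by rw [Gam_X])).symm
  have hC := hS.map (Polynomial.C : SymF →+* Polynomial SymF)
  have hT : IsExpSeries
      (PowerSeries.mk fun n => (Polynomial.monomial n (C (PowerSeries.coeff n κ)) : Polynomial SymF))
      fun i => Polynomial.monomial (i + 1) (C (c i * g i)) := by
    refine .of_coeff ?_ fun n => ?_
    · have := hκ.1
      rw [← PowerSeries.coeff_zero_eq_constantCoeff_apply] at this
      rw [PowerSeries.coeff_mk, this]
      simp
    · have := congrArg (fun x => (Polynomial.monomial (n + 1) (C x : SymF) : Polynomial SymF))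
        (hκ.coeff_succ n)
      simp only [PowerSeries.coeff_mk, map_mul, map_sum] at this ⊢
      have h1 : ((n : Polynomial SymF) + 1) = Polynomial.C (C ((n : K) + 1)) := by simp
      rw [h1, Polynomial.monomial_mul_C, this]
      refine Finset.sum_congr rfl fun ij hij => ?_
      rw [HasAntidiagonal.mem_antidiagonal] at hij
      rw [Polynomial.monomial_mul_monomial, show ij.1 + 1 + ij.2 = n + 1 by omega]
  have key := hG.unique (p := fun i => c i • (Polynomial.C (X i) +
    Polynomial.monomial (i + 1) (C (g i)))) (B := _ * _) (by
      convert hC.mul hT using 1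
      funext i
      rw [smul_add, Polynomial.smul_monomial, smul_eq_C_mul, C_mul, Polynomial.smul_C])
  have := congrArg (fun s => (PowerSeries.coeff n s).coeff k) key
  simp only [PowerSeries.coeff_mk, PowerSeries.coeff_mul, PowerSeries.coeff_map,
    Polynomial.finsetSum_coeff, Polynomial.coeff_C_mul, Polynomial.coeff_monomial] at this
  rw [skew_apply, this]
  split_ifs with hk
  · rw [Finset.sum_eq_single (n - k, k)]
    · simp [smul_eq_C_mul, mul_comm]
    · intro ij hij hne
      rw [HasAntidiagonal.mem_antidiagonal] at hij
      rw [if_neg, mul_zero]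
      intro h
      exact hne (Prod.ext (by simp only; omega) h)
    · intro h
      exact absurd (HasAntidiagonal.mem_antidiagonal.2 (by simp only; omega)) h
  · refine Finset.sum_eq_zero fun ij hij => ?_
    rw [HasAntidiagonal.mem_antidiagonal] at hij
    rw [if_neg (by omega), mul_zero]

theorem skew_scal_hZ {c g : ℕ → K} {κ : PowerSeries K} (hκ : IsExpSeries κ fun i => c i * g i)
    (k : ℕ) (m : ℤ) :
    skew g k (scal c (hZ m)) = PowerSeries.coeff k κ • scal c (hZ (m - k)) := by
  rw [hZ, hZ]
  split_ifs with h1 h2 h2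
  · simp
  · omega
  · rw [skew_scal_hP hκ, if_neg (by omega)]
    simp
  · rw [skew_scal_hP hκ, if_pos (by omega)]
    congr 3
    omega

/-! ### The operators adding a part to a Hall–Littlewood function -/

/-- the operator adjoint to multiplication by `h_k` -/
abbrev Lop (k : ℕ) : SymF →ₗ[K] SymF := skew (fun _ => 1) k

/-- the operator adjoint to multiplication by `(-1)^k e_k` -/
abbrev Dop (k : ℕ) : SymF →ₗ[K] SymF := skew (fun _ => -1) k

/-- the function `q_m(x; t)`, with generating series `Π_i (1 - t x_i u) / (1 - x_i u)` -/
def qZ (t : K) (m : ℤ) : SymF := scal (fun i => 1 - t ^ (i + 1)) (hZ m)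

theorem qZ_of_neg (t : K) {m : ℤ} (h : m < 0) : qZ t m = 0 := by
  rw [qZ, hZ, if_pos h, map_zero]

theorem qZ_natCast (t : K) (m : ℕ) : qZ t m = scal (fun i => 1 - t ^ (i + 1)) (hP m) := by
  rw [qZ, hZ, if_neg (by omega)]
  simp

theorem qZ_zero (t : K) : qZ t 0 = 1 := by
  have := qZ_natCast t 0
  rwa [hP_zero, map_one] at this

theorem Lop_qZ (t : K) (k : ℕ) (m : ℤ) :
    Lop k (qZ t m) = (if k = 0 then 1 else 1 - t) • qZ t (m - k) := by
  have h : IsExpSeries ((PowerSeries.mk fun n => (1 : K) ^ n) * (1 - PowerSeries.C t * PowerSeries.X))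
      fun i => (1 - t ^ (i + 1)) * 1 := by
    convert (IsExpSeries.geometric (1 : K)).mul (IsExpSeries.one_sub_mul_X t) using 2
    simp [sub_eq_add_neg]
  rw [qZ, Lop, skew_scal_hZ h]
  congr 1
  rw [mul_sub, mul_one, mul_left_comm, ← PowerSeries.smul_eq_C_mul]
  rcases k with _ | k
  · simp
  · rw [map_sub, PowerSeries.coeff_smul, PowerSeries.coeff_succ_mul_X]
    simp

theorem Dop_qZ (t : K) (k : ℕ) (m : ℤ) :
    Dop k (qZ t m) = (if k = 0 then 1 else t ^ k - t ^ (k - 1)) • qZ t (m - k) := by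
  have h : IsExpSeries ((PowerSeries.mk fun n => t ^ n) * (1 - PowerSeries.C 1 * PowerSeries.X))
      fun i => (1 - t ^ (i + 1)) * -1 := by
    convert (IsExpSeries.geometric t).mul (IsExpSeries.one_sub_mul_X 1) using 2
    simp [sub_eq_add_neg]
  rw [qZ, Dop, skew_scal_hZ h]
  congr 1
  rw [mul_sub, mul_one, mul_left_comm, ← PowerSeries.smul_eq_C_mul]
  rcases k with _ | k
  · simp
  · rw [map_sub, PowerSeries.coeff_smul, PowerSeries.coeff_succ_mul_X]
    simp

/-- the linear map `T^k ↦ q_{a+k}` -/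
def Lam (t : K) (a : ℤ) : Polynomial SymF →ₗ[SymF] SymF :=
  Polynomial.lsum fun k => LinearMap.mulLeft SymF (qZ t (a + k))

theorem Lam_monomial (t : K) (a : ℤ) (k : ℕ) (x : SymF) :
    Lam t a (Polynomial.monomial k x) = qZ t (a + k) * x := by
  rw [Lam, Polynomial.lsum_apply, Polynomial.sum_monomial_index]
  · rfl
  · simp

theorem Lam_monomial_mul (t : K) (a : ℤ) (k : ℕ) (x : SymF) (G : Polynomial SymF) :
    Lam t a (Polynomial.monomial k x * G) = x * Lam t (a + k) G := by
  induction G using Polynomial.induction_on' with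
  | add p r hp hr => rw [mul_add, map_add, map_add, hp, hr, mul_add]
  | monomial m y =>
    rw [Polynomial.monomial_mul_monomial, Lam_monomial, Lam_monomial]
    push_cast
    rw [add_assoc]
    ring

/-- the operator `B_a = Σ_k q_{a+k} D_k` -/
def Hop (t : K) (a : ℤ) : SymF →ₗ[K] SymF :=
  ((Lam t a).restrictScalars K).comp (Gam fun _ => -1).toLinearMap

theorem Hop_apply (t : K) (a : ℤ) (f : SymF) : Hop t a f = Lam t a (Gam (fun _ => -1) f) := rfl

theorem exists_skew_eq_zero (g : ℕ → K) (f : SymF) : ∃ N, ∀ k, N ≤ k → skew g k f = 0 :=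
  ⟨(Gam g f).natDegree + 1, fun k hk => by
    rw [skew_apply]
    exact Polynomial.coeff_eq_zero_of_natDegree_lt hk⟩

theorem Gam_eq_sum {g : ℕ → K} {f : SymF} {N : ℕ} (h : ∀ k, N ≤ k → skew g k f = 0) :
    Gam g f = ∑ k ∈ range N, Polynomial.monomial k (skew g k f) := by
  ext1 m
  simp only [Polynomial.finsetSum_coeff, Polynomial.coeff_monomial, Finset.sum_ite_eq', mem_range]
  split_ifs with hm
  · rfl
  · rw [← skew_apply, h m (by omega)]

theorem Hop_eq_sum (t : K) (a : ℤ) {f : SymF} {N : ℕ} (h : ∀ k, N ≤ k → Dop k f = 0) :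
    Hop t a f = ∑ k ∈ range N, qZ t (a + k) * Dop k f := by
  rw [Hop_apply, Gam_eq_sum h, map_sum]
  simp only [Lam_monomial]

theorem skew_Hop {t : K} {g κ : ℕ → K}
    (hq : ∀ k (m : ℤ), skew g k (qZ t m) = κ k • qZ t (m - k)) (a : ℤ) (k : ℕ) (f : SymF) :
    skew g k (Hop t a f)
      = ∑ ij ∈ antidiagonal k, κ ij.1 • Hop t (a - ij.1) (skew g ij.2 f) := by
  obtain ⟨N, hN⟩ := exists_skew_eq_zero (fun _ => -1) f
  have hN' (j : ℕ) : ∀ k, N ≤ k → Dop k (skew g j f) = 0 := fun k hk => by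
    rw [Dop, skew_comm, hN k hk, map_zero]
  rw [Hop_eq_sum t a hN, map_sum]
  simp only [Hop_eq_sum t _ (hN' _), skew_mul, Finset.smul_sum]
  rw [Finset.sum_comm]
  refine Finset.sum_congr rfl fun ij _ => Finset.sum_congr rfl fun l _ => ?_
  rw [hq, skew_comm, smul_mul_assoc, add_sub_right_comm]

theorem Lop_Hop (t : K) (a : ℤ) (k : ℕ) (f : SymF) :
    Lop k (Hop t a f) = ∑ ij ∈ antidiagonal k,
      (if ij.1 = 0 then 1 else 1 - t) • Hop t (a - ij.1) (Lop ij.2 f) :=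
  skew_Hop (κ := fun k => if k = 0 then 1 else 1 - t) (Lop_qZ t) a k f

theorem sum_scal_hP_mul (g g' : ℕ → K) (m : ℕ) :
    ∑ ij ∈ antidiagonal m, scal g (hP ij.1) * scal g' (hP ij.2)
      = scal (fun i => g i + g' i) (hP m) := by
  have hS (c : ℕ → K) : IsExpSeries (PowerSeries.map (scal c).toRingHom (PowerSeries.mk hP))
      fun i => c i • (X i : SymF) := by
    convert isExpSeries_hP.map (scal c).toRingHom using 1
    funext i
    exact (scal_X c i).symm
  have h := (hS g).mul (hS g')
  simp only [← add_smul] at h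
  simpa [PowerSeries.coeff_mul] using congrArg (PowerSeries.coeff m) (h.unique (hS fun i => g i + g' i))

theorem sum_skew_skew (g g' : ℕ → K) (m : ℕ) (f : SymF) :
    ∑ ij ∈ antidiagonal m, skew g ij.1 (skew g' ij.2 f) = skew (fun i => g i + g' i) m f := by
  refine eq_of_hall_eq _ _ fun u => ?_
  rw [hall_sum_right, ← hall_scal_hP_mul, ← sum_scal_hP_mul, Finset.sum_mul, hall_sum_left]
  refine Finset.sum_congr rfl fun ij _ => ?_
  rw [← hall_scal_hP_mul, ← hall_scal_hP_mul, mul_assoc, mul_left_comm]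

theorem skew_zero_fun (m : ℕ) (f : SymF) :
    skew (fun _ => 0) m f = if m = 0 then f else 0 := by
  have : Gam (fun _ => 0) f = Polynomial.C f := by
    have : Gam (fun _ => 0) = (Algebra.ofId SymF (Polynomial SymF)).restrictScalars K := by
      refine MvPolynomial.algHom_ext fun i => ?_
      rw [Gam_X]
      simp
    rw [this]
    rfl
  rw [skew_apply, this, Polynomial.coeff_C]

theorem sum_Hop_Lop (t : K) (b : ℤ) {f : SymF} {N : ℕ} (h : ∀ k, N ≤ k → Lop k f = 0) :
    ∑ l ∈ range N, Hop t (b + l) (Lop l f) = qZ t b * f := by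
  have key : ∑ l ∈ range N, Polynomial.monomial l 1 * Gam (fun _ => -1) (Lop l f)
      = Polynomial.C f := by
    ext1 m
    have h1 := sum_skew_skew (fun _ => -1) (fun _ => 1) m f
    simp only [neg_add_cancel] at h1
    rw [skew_zero_fun] at h1
    rw [Polynomial.coeff_C, ← h1, Polynomial.finsetSum_coeff, ← Finset.Nat.sum_antidiagonal_swap,
      Finset.Nat.sum_antidiagonal_eq_sum_range_succ_mk]
    simp only [Polynomial.monomial_one_right_eq_X_pow, Polynomial.coeff_X_pow_mul', Prod.swap]
    rw [← Finset.sum_filter]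
    refine Finset.sum_subset_zero_on_sdiff ?_ ?_ ?_
    · intro l hl
      simp only [mem_filter, mem_range] at hl ⊢
      omega
    · intro l hl
      simp only [mem_sdiff, mem_filter, mem_range] at hl
      rw [show skew (fun _ => 1) l f = 0 from h l (by omega), map_zero]
    · intro l _
      rfl
  have h2 := congrArg (Lam t b) key
  rw [map_sum, ← Polynomial.monomial_zero_left, Lam_monomial] at h2
  simp only [Lam_monomial_mul, one_mul, Nat.cast_zero, add_zero] at h2
  exact h2

theorem Hop_qZ_mul (t : K) (a : ℤ) (b : ℕ) (f : SymF) :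
    Hop t a (qZ t b * f) = ∑ i ∈ range (b + 1),
      (if i = 0 then 1 else t ^ i - t ^ (i - 1)) • (qZ t (b - i : ℕ) * Hop t (a + i) f) := by
  have h : ∀ k, b + 1 ≤ k → skew (fun _ => -1) k (qZ t b) = 0 := fun k hk => by
    rw [Dop_qZ, qZ_of_neg t (by omega), smul_zero]
  rw [Hop_apply, map_mul, Gam_eq_sum h, Finset.sum_mul, map_sum]
  refine Finset.sum_congr rfl fun i hi => ?_
  rw [mem_range] at hi
  rw [Lam_monomial_mul, Dop_qZ, ← Hop_apply, smul_mul_assoc, Nat.cast_sub (by omega)]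

theorem Hop_one (t : K) (a : ℤ) : Hop t a 1 = qZ t a := by
  rw [Hop_apply, map_one, ← Polynomial.monomial_zero_one, Lam_monomial]
  simp

/-! ### Supports with respect to products of complete homogeneous functions -/

/-- the product of complete homogeneous functions indexed by a list -/
def hL (κ : List ℕ) : SymF := (κ.map hP).prod

theorem hL_cons (k : ℕ) (κ : List ℕ) : hL (k :: κ) = hP k * hL κ := by simp [hL]

theorem hL_perm {κ κ' : List ℕ} (h : κ.Perm κ') : hL κ = hL κ' := (h.map hP).prod_eq

theorem hall_hL_cons (f : SymF) (k : ℕ) (κ : List ℕ) :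
    hall f (hL (k :: κ)) = hall (Lop k f) (hL κ) := by
  rw [Lop, hall_skew, scal_one, hL_cons]

theorem span_hL : Submodule.span K (Set.range hL) = ⊤ := by
  have hX (n : ℕ) : (X n : SymF) ∈ Algebra.adjoin K (Set.range hP) := by
    induction n using Nat.strong_induction_on with
    | _ n ih =>
      have h := newton_hP n
      rw [Finset.Nat.sum_antidiagonal_eq_sum_range_succ_mk, Finset.sum_range_succ] at h
      simp only [Nat.sub_self, hP_zero, mul_one] at h
      rw [eq_sub_of_add_eq' h.symm]
      refine sub_mem (mul_mem (natCast_mem _ _) (Algebra.subset_adjoin ⟨_, rfl⟩)) ?_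
      exact sum_mem fun i hi => mul_mem (ih i (mem_range.1 hi)) (Algebra.subset_adjoin ⟨_, rfl⟩)
  have htop : Algebra.adjoin K (Set.range hP) = ⊤ := by
    rw [eq_top_iff, ← MvPolynomial.adjoin_range_X]
    refine Algebra.adjoin_le ?_
    rintro _ ⟨n, rfl⟩
    exact hX n
  have h := congrArg Subalgebra.toSubmodule htop
  rw [Algebra.adjoin_eq_span, Algebra.top_toSubmodule] at h
  rw [eq_top_iff, ← h]
  refine Submodule.span_mono fun x hx => ?_
  obtain ⟨l, hl, rfl⟩ := Submonoid.exists_list_of_mem_closure hx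
  choose! k hk using hl
  refine ⟨l.map k, ?_⟩
  rw [hL, List.map_map]
  congr 1
  conv_rhs => rw [← List.map_id l]
  exact List.map_congr_left fun y hy => hk y hy

theorem eq_zero_of_hall_hL (f : SymF) (h : ∀ κ, hall f (hL κ) = 0) : f = 0 := by
  refine eq_zero_of_hall_eq_zero f fun g => ?_
  have hg : g ∈ Submodule.span K (Set.range hL) := span_hL ▸ Submodule.mem_top
  rw [← hallB_apply]
  induction hg using Submodule.span_induction with
  | mem x hx =>
    obtain ⟨κ, rfl⟩ := hx
    exact h κ
  | zero => exact map_zero _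
  | add x y _ _ hx hy => rw [map_add, hx, hy, add_zero]
  | smul a x _ hx => rw [map_smul, hx, smul_zero]

/-- the monomials of `f` have their partial sums of exponents bounded by `w` -/
def Bd (w : ℕ → ℤ) (f : SymF) : Prop :=
  ∀ κ, hall f (hL κ) ≠ 0 → ∀ p, ((κ.take p).sum : ℤ) ≤ w p

theorem Bd.mono {w w' : ℕ → ℤ} {f : SymF} (h : Bd w f) (hw : ∀ p, w p ≤ w' p) : Bd w' f :=
  fun κ hκ p => (h κ hκ p).trans (hw p)

theorem Bd.nonneg {w : ℕ → ℤ} {f : SymF} (h : Bd w f) (hf : f ≠ 0) (p : ℕ) : 0 ≤ w p := by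
  by_contra hw
  refine hf (eq_zero_of_hall_hL f fun κ => ?_)
  by_contra hκ
  have := h κ hκ p
  omega

theorem Bd.Lop {w : ℕ → ℤ} {f : SymF} (h : Bd w f) (l : ℕ) :
    Bd (fun p => min (w p) (w (p + 1) - l)) (Lop l f) := by
  intro κ hκ p
  rw [← hall_hL_cons] at hκ
  have h1 := h _ hκ (p + 1)
  rw [hL_perm (List.perm_append_singleton l κ).symm] at hκ
  have h2 := h _ hκ p
  rw [List.take_append, List.sum_append] at h2
  rw [List.take_succ_cons, List.sum_cons] at h1
  rw [Nat.cast_add] at h1 h2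
  have : (0 : ℤ) ≤ ((List.take (p - κ.length) [l]).sum : ℕ) := Int.natCast_nonneg _
  rw [le_min_iff]
  constructor <;> omega

theorem Bd.Lop_eq_zero {w : ℕ → ℤ} {f : SymF} (h : Bd w f) {l : ℕ} (hl : w 1 < l) :
    _root_.Lop l f = 0 := by
  by_contra hne
  have := (h.Lop l).nonneg hne 0
  simp only [zero_add, le_min_iff] at this
  omega

theorem Lop_Hop_eq (t : K) (a : ℤ) (k : ℕ) (f : SymF) :
    Lop k (Hop t a f) = t • Hop t a (Lop k f)
      + (1 - t) • ∑ l ∈ range (k + 1), Hop t (a - k + l) (Lop l f) := by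
  rw [Lop_Hop, ← Finset.Nat.sum_antidiagonal_swap, Finset.Nat.sum_antidiagonal_eq_sum_range_succ_mk,
    Finset.sum_range_succ, Finset.sum_range_succ, smul_add, Finset.smul_sum, add_left_comm]
  congr 1
  · refine Finset.sum_congr rfl fun l hl => ?_
    rw [mem_range] at hl
    simp only [Prod.swap]
    rw [if_neg (by omega), Nat.cast_sub hl.le]
    congr 3
    ring
  · simp only [Prod.swap, Nat.sub_self, if_true, one_smul, Nat.cast_zero, sub_zero, sub_add_cancel]
    rw [← add_smul, add_sub_cancel, one_smul]

theorem exists_of_hall_sum_ne_zero {ι : Type*} {s : Finset ι} {F : ι → SymF} {g : SymF}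
    (h : hall (∑ i ∈ s, F i) g ≠ 0) : ∃ i ∈ s, hall (F i) g ≠ 0 := by
  rw [hall_sum_left] at h
  exact Finset.exists_ne_zero_of_sum_ne_zero h

theorem exists_Hop_ne_zero {t : K} {a : ℤ} {k : ℕ} {f g : SymF}
    (h : hall (Lop k (Hop t a f)) g ≠ 0) :
    ∃ l : ℕ, ((k ≤ a ∧ l ≤ k) ∨ (a < k ∧ k ≤ l)) ∧ hall (Hop t (a - k + l) (Lop l f)) g ≠ 0 := by
  rw [Lop_Hop_eq] at h
  by_cases h0 : hall (Hop t a (Lop k f)) g = 0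
  · rw [hall_add_left, hall_smul_left, h0, mul_zero, zero_add, hall_smul_left] at h
    replace h := right_ne_zero_of_mul h
    rcases le_or_gt (k : ℤ) a with ha | ha
    · obtain ⟨l, hl, hne⟩ := exists_of_hall_sum_ne_zero h
      exact ⟨l, Or.inl ⟨ha, Nat.lt_succ_iff.1 (mem_range.1 hl)⟩, hne⟩
    · obtain ⟨N, hN⟩ := exists_skew_eq_zero (fun _ => 1) f
      have h1 := sum_Hop_Lop t (a - k) (N := N + (k + 1)) (f := f) fun j hj => hN j (by omega)
      rw [qZ_of_neg t (by omega), zero_mul, add_comm N, Finset.sum_range_add] at h1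
      rw [eq_neg_of_add_eq_zero_left h1, ← neg_one_smul K, hall_smul_left] at h
      obtain ⟨l, -, hne⟩ := exists_of_hall_sum_ne_zero (right_ne_zero_of_mul h)
      exact ⟨k + 1 + l, Or.inr ⟨ha, by omega⟩, hne⟩
  · refine ⟨k, ?_, by rwa [sub_add_cancel]⟩
    rcases le_or_gt (k : ℤ) a with ha | ha
    · exact Or.inl ⟨ha, le_rfl⟩
    · exact Or.inr ⟨ha, le_rfl⟩

theorem Bd.Hop {w : ℕ → ℤ} {f : SymF} (h : Bd w f) (t : K) (a : ℤ) {w' : ℕ → ℤ}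
    (h0 : w' 0 = w 0) (hs : ∀ p, w' (p + 1) = max (w (p + 1)) (a + w p)) :
    Bd w' (Hop t a f) := by
  intro κ
  induction κ generalizing f w a w' with
  | nil =>
    intro hκ p
    have hf : f ≠ 0 := by
      rintro rfl
      simp [hall_zero_left] at hκ
    rcases p with _ | p
    · simpa [h0] using h.nonneg hf 0
    · simpa [hs] using Or.inl (h.nonneg hf (p + 1))
  | cons k κ ih =>
    intro hκ p
    rw [hall_hL_cons] at hκ
    have hf : f ≠ 0 := by
      rintro rfl
      simp [hall_zero_left] at hκ
    rcases p with _ | p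
    · simpa [h0] using h.nonneg hf 0
    · obtain ⟨l, hl, hne⟩ := exists_Hop_ne_zero hκ
      have key := ih (h.Lop l) (a - k + l)
        (w' := fun p => Nat.casesOn p (min (w 0) (w 1 - l))
          fun p => max (min (w (p + 1)) (w (p + 2) - l)) (a - k + l + min (w p) (w (p + 1) - l)))
        rfl (fun _ => rfl) hne p
      rw [List.take_succ_cons, List.sum_cons, hs, Nat.cast_add]
      clear hs ih
      rcases p with _ | p
      · simp at key ⊢
        omega
      · simp only [show p + 1 + 1 = p + 2 from rfl] at key ⊢
        omega

/-! ### Hall–Littlewood functions -/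

/-- the Hall–Littlewood function `Q_λ(x; t)`, defined for arbitrary compositions -/
def QL (t : K) : List ℕ → SymF
  | [] => 1
  | a :: l => Hop t a (QL t l)

theorem Lop_one {k : ℕ} (hk : k ≠ 0) : Lop k 1 = 0 := by
  rw [← C_1, Lop, skew_C, if_neg hk]

theorem Bd_one : Bd (fun _ => 0) 1 := by
  intro κ hκ p
  induction κ generalizing p with
  | nil => simp
  | cons k κ ih =>
    rw [hall_hL_cons] at hκ
    rcases eq_or_ne k 0 with rfl | hk
    · rw [← C_1, Lop, skew_C, if_pos rfl, C_1] at hκ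
      rcases p with _ | p
      · simp
      · simpa using ih hκ p
    · rw [Lop_one hk, hall_zero_left] at hκ
      exact absurd rfl hκ

theorem sum_take_succ_le {l : List ℕ} {a : ℕ} (h : ∀ b ∈ l, b ≤ a) (p : ℕ) :
    (l.take (p + 1)).sum ≤ a + (l.take p).sum := by
  rcases lt_or_ge p l.length with hp | hp
  · rw [List.sum_take_succ _ _ hp, add_comm]
    exact Nat.add_le_add_right (h _ (List.getElem_mem hp)) _
  · rw [List.take_of_length_le (by omega), List.take_of_length_le hp]
    omega

theorem Bd_QL (t : K) {l : List ℕ} (hl : l.SortedGE) :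
    Bd (fun p => ((l.take p).sum : ℕ)) (QL t l) := by
  induction l with
  | nil => simpa [QL] using Bd_one
  | cons a l ih =>
    rw [List.sortedGE_iff_pairwise, List.pairwise_cons] at hl
    refine (ih (List.sortedGE_iff_pairwise.2 hl.2)).Hop t a (by simp) fun p => ?_
    have := sum_take_succ_le hl.1 p
    rw [List.take_succ_cons, List.sum_cons]
    rw [Nat.cast_add]
    omega

theorem Lop_QL_eq_zero (t : K) {l : List ℕ} (hl : l.SortedGE) {k : ℕ} (hk : l.headD 0 < k) :
    Lop k (QL t l) = 0 := by
  refine (Bd_QL t hl).Lop_eq_zero ?_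
  rcases l with _ | ⟨a, l⟩ <;> simpa using hk

theorem Lop_QL_cons (t : K) {m : ℕ} {l : List ℕ} (hl : (m :: l).SortedGE) (hm : 0 < m) :
    Lop m (QL t (m :: l)) = (1 - t ^ (l.count m + 1)) • QL t l := by
  induction l with
  | nil =>
    simp only [QL]
    rw [Hop_one, Lop_qZ, if_neg hm.ne']
    simp [qZ_zero]
  | cons a l ih =>
    have hl' := hl
    rw [List.sortedGE_iff_pairwise, List.pairwise_cons] at hl'
    have hal : (a :: l).SortedGE := List.sortedGE_iff_pairwise.2 hl'.2
    have ham : a ≤ m := hl'.1 a (by simp)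
    have h0 (k : ℕ) (hk : m + 1 ≤ k) : Lop k (QL t (a :: l)) = 0 :=
      Lop_QL_eq_zero t hal (by simp; omega)
    have h1 := sum_Hop_Lop t 0 h0
    rw [qZ_zero, one_mul] at h1
    rw [QL, Lop_Hop_eq, sub_self, h1]
    rcases ham.eq_or_lt with rfl | ham
    · rw [ih hal, map_smul, ← QL, smul_smul, ← add_smul]
      congr 1
      rw [List.count_cons_self]
      ring
    · rw [Lop_QL_eq_zero t hal (by simpa using ham), map_zero, smul_zero, zero_add,
        List.count_eq_zero_of_not_mem, zero_add, pow_one]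
      intro hmem
      rw [List.pairwise_cons] at hl'
      rcases List.mem_cons.1 hmem with h | h
      · omega
      · have := hl'.2.1 m h
        omega

/-- the factor `b_λ(t) = Π_i Π_{k ≤ m_i(λ)} (1 - t^k)` -/
def bL (t : K) : List ℕ → K
  | [] => 1
  | m :: l => (1 - t ^ (l.count m + 1)) * bL t l

theorem hall_QL_hL (t : K) {l : List ℕ} (hl : l.SortedGE) (hpos : ∀ a ∈ l, 0 < a) :
    hall (QL t l) (hL l) = bL t l := by
  induction l with
  | nil => simp [QL, hL, bL, hall_one_left]
  | cons m l ih =>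
    rw [hall_hL_cons, Lop_QL_cons t hl (hpos m (by simp)), hall_smul_left, bL,
      ih (List.sortedGE_iff_pairwise.2 (List.pairwise_cons.1 (List.sortedGE_iff_pairwise.1 hl)).2)
        fun a ha => hpos a (by simp [ha])]

/-- the product of the functions `q_m` indexed by a list -/
def qL (t : K) (α : List ℕ) : SymF := (α.map fun a : ℕ => qZ t a).prod

theorem qL_cons (t : K) (a : ℕ) (α : List ℕ) : qL t (a :: α) = qZ t a * qL t α := by simp [qL]

/-- the compositions strictly above `l` in dominance order, of the same length -/
def Above (l : List ℕ) : Set (List ℕ) :=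
  {α | α.length = l.length ∧ α.sum = l.sum ∧ (∀ p, (l.take p).sum ≤ (α.take p).sum) ∧ α ≠ l}

theorem eq_of_sum_take_eq {α β : List ℕ} (hlen : α.length = β.length)
    (h : ∀ p, (α.take p).sum = (β.take p).sum) : α = β := by
  refine List.ext_getElem hlen fun p h1 h2 => ?_
  have := h (p + 1)
  rw [List.sum_take_succ _ _ h1, List.sum_take_succ _ _ h2, h p] at this
  omega

theorem Above.trans {α β γ : List ℕ} (h : β ∈ Above α) (h' : γ ∈ Above β) : γ ∈ Above α := by
  refine ⟨h'.1.trans h.1, h'.2.1.trans h.2.1, fun p => (h.2.2.1 p).trans (h'.2.2.1 p), ?_⟩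
  rintro rfl
  exact h.2.2.2 (eq_of_sum_take_eq h.1 fun p => le_antisymm (h'.2.2.1 p) (h.2.2.1 p))

theorem Above.cons {α β : List ℕ} (a : ℕ) (h : β ∈ Above α) : a :: β ∈ Above (a :: α) := by
  obtain ⟨h1, h2, h3, h4⟩ := h
  refine ⟨by simp [h1], by simp [h2], fun p => ?_, by simpa using h4⟩
  rcases p with _ | p
  · simp
  · simpa using h3 p

theorem Above.exchange {a b c i : ℕ} {α β : List ℕ} (hi : i ≤ b)
    (hlen : (c :: β).length = ((a + i) :: α).length) (hsum : (c :: β).sum = ((a + i) :: α).sum)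
    (hpre : ∀ p, (((a + i) :: α).take p).sum ≤ ((c :: β).take p).sum)
    (hne : i = 0 → c :: β ≠ a :: α) : c :: (b - i) :: β ∈ Above (a :: b :: α) := by
  refine ⟨by simpa using hlen, ?_, fun p => ?_, ?_⟩
  · simp at hsum ⊢
    omega
  · have h1 := hpre 1
    rcases p with _ | _ | p
    · simp
    · simp at h1 ⊢
      omega
    · have := hpre (p + 1)
      simp at this ⊢
      omega
  · intro h
    have h1 := hpre 1
    simp at h h1
    obtain ⟨rfl, h2, rfl⟩ := h
    exact hne (by omega) rfl

theorem map_mem_of_span {S : Set (List ℕ)} {t : K} {M : Submodule K SymF} (φ : SymF →ₗ[K] SymF)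
    (h : ∀ β ∈ S, φ (qL t β) ∈ M) {x : SymF} (hx : x ∈ Submodule.span K (qL t '' S)) :
    φ x ∈ M := by
  have : Submodule.span K (qL t '' S) ≤ M.comap φ := by
    rw [Submodule.span_le]
    rintro _ ⟨β, hβ, rfl⟩
    exact h β hβ
  exact this hx

theorem Hop_qL_sub_mem (t : K) (a : ℕ) (α : List ℕ) :
    Hop t a (qL t α) - qL t (a :: α) ∈ Submodule.span K (qL t '' Above (a :: α)) := by
  induction α generalizing a with
  | nil =>
    have h : Hop t a (qL t []) = qL t [a] := by simp [qL, Hop_one]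
    rw [h, sub_self]
    exact zero_mem _
  | cons b α ih =>
    have hswap (c m : ℕ) (β : List ℕ) : qZ t m * qL t (c :: β) = qL t (c :: m :: β) := by
      simp only [qL_cons]
      ring
    have hcons {c : ℕ} {γ β : List ℕ} (h : β ∈ Above (c :: γ)) : ∃ d δ, β = d :: δ := by
      rcases β with _ | ⟨d, δ⟩
      · simpa using h.1
      · exact ⟨d, δ, rfl⟩
    rw [qL_cons, Hop_qZ_mul, Finset.sum_range_succ', if_pos rfl, one_smul, add_sub_assoc]
    refine add_mem (sum_mem fun i hi => Submodule.smul_mem _ _ ?_) ?_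
    · rw [mem_range] at hi
      have h1 := ih (a + (i + 1))
      rw [← sub_add_cancel (Hop t _ _) (qL t ((a + (i + 1)) :: α)), mul_add]
      rw [Nat.cast_add] at h1
      refine add_mem (map_mem_of_span (LinearMap.mulLeft K (qZ t ((b - (i + 1) : ℕ) : ℤ)))
        (fun β hβ => ?_) h1) ?_
      · obtain ⟨c, δ, rfl⟩ := hcons hβ
        rw [LinearMap.mulLeft_apply, hswap]
        exact Submodule.subset_span ⟨_, Above.exchange (by omega) hβ.1 hβ.2.1 hβ.2.2.1 (by omega), rfl⟩
      · rw [hswap]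
        exact Submodule.subset_span
          ⟨_, Above.exchange (by omega) rfl rfl (fun _ => le_rfl) (by omega), rfl⟩
    · have h2 : qL t (a :: b :: α) = qZ t b * qL t (a :: α) := (hswap a b α).symm
      simp only [Nat.sub_zero, Nat.cast_zero, add_zero]
      rw [h2, ← mul_sub]
      refine map_mem_of_span (LinearMap.mulLeft K (qZ t b)) (fun β hβ => ?_) (ih a)
      obtain ⟨c, δ, rfl⟩ := hcons hβ
      rw [LinearMap.mulLeft_apply, hswap]
      exact Submodule.subset_span
        ⟨_, Above.exchange (i := 0) (by omega) hβ.1 hβ.2.1 hβ.2.2.1 fun _ => hβ.2.2.2, rfl⟩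

theorem QL_sub_mem (t : K) (l : List ℕ) :
    QL t l - qL t l ∈ Submodule.span K (qL t '' Above l) := by
  induction l with
  | nil =>
    have h : QL t [] = qL t [] := by simp [qL, QL]
    rw [h, sub_self]
    exact zero_mem _
  | cons a l ih =>
    have h : QL t (a :: l) - qL t (a :: l)
        = Hop t a (QL t l - qL t l) + (Hop t a (qL t l) - qL t (a :: l)) := by
      rw [map_sub, QL]
      abel
    rw [h]
    refine add_mem (map_mem_of_span (Hop t a) (fun β hβ => ?_) ih) (Hop_qL_sub_mem t a l)
    rw [← sub_add_cancel (Hop t a (qL t β)) (qL t (a :: β))]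
    refine add_mem ?_ (Submodule.subset_span ⟨_, Above.cons a hβ, rfl⟩)
    refine Submodule.span_mono ?_ (Hop_qL_sub_mem t a β)
    exact Set.image_mono fun γ hγ => Above.trans (Above.cons a hβ) hγ

/-- pairings with `Q_λ`, when only one term of its triangular expansion contributes -/
theorem hall_QL_of_above {t : K} {l : List ℕ} {g : SymF}
    (h : ∀ α ∈ Above l, hall (qL t α) g = 0) : hall (QL t l) g = hall (qL t l) g := by
  have h1 : hall (QL t l - qL t l) g = 0 := by
    rw [hall_comm, ← hallB_apply]
    have h2 : Submodule.span K (qL t '' Above l) ≤ LinearMap.ker (hallB g) := by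
      rw [Submodule.span_le]
      rintro _ ⟨β, hβ, rfl⟩
      rw [SetLike.mem_coe, LinearMap.mem_ker, hallB_apply, hall_comm]
      exact h β hβ
    exact h2 (QL_sub_mem t l)
  rw [hall_comm, ← hallB_apply, map_sub, hallB_apply, hallB_apply, sub_eq_zero] at h1
  rw [hall_comm, h1, hall_comm]

theorem qZ_zero_left (m : ℤ) : qZ 0 m = hZ m := by
  rw [qZ]
  simp only [zero_pow (Nat.succ_ne_zero _), sub_zero, scal_one]

theorem qL_zero (α : List ℕ) : qL 0 α = hL α := by
  rw [qL, hL]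
  congr 1
  refine List.map_congr_left fun a _ => ?_
  rw [qZ_zero_left, hZ, if_neg (by omega)]
  simp

theorem bL_zero (l : List ℕ) : bL 0 l = 1 := by
  induction l with
  | nil => rfl
  | cons m l ih => rw [bL, ih, zero_pow (Nat.succ_ne_zero _), sub_zero, one_mul]

/-! ### Schur functions -/

theorem Gam_hZ (m : ℤ) : Gam (fun _ => -1) (hZ m)
    = Polynomial.C (hZ m) - Polynomial.X * Polynomial.C (hZ (m - 1)) := by
  have h (k : ℕ) := Dop_qZ 0 k m
  simp only [qZ_zero_left] at h
  ext1 k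
  rw [← skew_apply, h, Polynomial.coeff_sub, Polynomial.coeff_C]
  rcases k with _ | _ | k
  · simp
  · simp
  · simp

theorem Hop_det (n : ℕ) (a : ℤ) (α : Fin n → ℤ) :
    Hop 0 a (Matrix.det (Matrix.of fun i j : Fin n => hZ (α i - (i : ℤ) + (j : ℤ))))
      = Matrix.det (Matrix.of fun i j : Fin (n + 1) =>
          hZ ((Fin.cons a α : Fin (n + 1) → ℤ) i - (i : ℤ) + (j : ℤ))) := by
  set M : Matrix (Fin (n + 1)) (Fin (n + 1)) (Polynomial SymF) := Matrix.of
    (Fin.cons (fun j => Polynomial.X ^ (j : ℕ))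
      fun i j => Polynomial.C (hZ (α i - ((i : ℤ) + 1) + (j : ℤ)))) with hM
  set M' : Matrix (Fin (n + 1)) (Fin (n + 1)) (Polynomial SymF) := Matrix.of
    (Fin.cons (Fin.cons 1 fun _ => 0)
      fun i => Fin.cons (Polynomial.C (hZ (α i - ((i : ℤ) + 1))))
        fun j => Gam (fun _ => -1) (hZ (α i - (i : ℤ) + (j : ℤ)))) with hM'
  have h1 : M.det = M'.det := by
    refine Matrix.det_eq_of_forall_col_eq_smul_add_pred (fun _ => Polynomial.X) (fun i => ?_)
      fun i j => ?_
    · refine Fin.cases ?_ (fun i => ?_) i <;> simp [M, M']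
    · refine Fin.cases ?_ (fun i => ?_) i
      · simp [M, M', pow_succ']
      · simp only [M, M', Matrix.of_apply, Fin.cons_succ, Gam_hZ, Fin.val_succ, Fin.val_castSucc]
        rw [show α i - ((i : ℤ) + 1) + ((j : ℕ) + 1 : ℕ) = α i - i + j by push_cast; ring,
          show α i - (i : ℤ) + (j : ℤ) - 1 = α i - ((i : ℤ) + 1) + j by ring]
        ring
  have h2 : M'.det = Gam (fun _ => -1)
      (Matrix.det (Matrix.of fun i j : Fin n => hZ (α i - (i : ℤ) + (j : ℤ)))) := by
    rw [Matrix.det_succ_row_zero, Fin.sum_univ_succ, AlgHom.map_det]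
    simp only [M', Matrix.of_apply, Fin.cons_zero, Fin.cons_succ]
    simp only [Fin.val_zero, pow_zero, mul_one, one_mul, mul_zero, zero_mul, Finset.sum_const_zero,
      add_zero]
    congr 1
  rw [Hop_apply, ← h2, ← h1, Matrix.det_succ_row_zero, Matrix.det_succ_row_zero, map_sum]
  refine Finset.sum_congr rfl fun j _ => ?_
  have h3 : (M.submatrix Fin.succ j.succAbove) = (Polynomial.C : SymF →+* _).mapMatrix
      ((Matrix.of fun i j : Fin (n + 1) =>
          hZ ((Fin.cons a α : Fin (n + 1) → ℤ) i - (i : ℤ) + (j : ℤ))).submatrix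
        Fin.succ j.succAbove) := by
    ext1 i k
    simp [M]
  rw [h3, ← RingHom.map_det]
  simp only [M, Matrix.of_apply, Fin.cons_zero, Fin.val_zero, Nat.cast_zero, sub_zero]
  rw [show ((-1 : Polynomial SymF) ^ (j : ℕ)) = Polynomial.C ((-1) ^ (j : ℕ)) by simp,
    mul_right_comm, ← Polynomial.C_mul, Polynomial.C_mul_X_pow_eq_monomial, Lam_monomial,
    qZ_zero_left]
  ring

theorem QL_zero_eq_det (l : List ℕ) : QL 0 l
    = Matrix.det (Matrix.of fun i j : Fin l.length => hZ ((l.get i : ℤ) - (i : ℤ) + (j : ℤ))) := by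
  induction l with
  | nil => simp [QL]
  | cons a l ih =>
    rw [QL, ih, Hop_det]
    congr 2
    funext i j
    congr 3
    refine Fin.cases ?_ (fun i => ?_) i <;> rfl

theorem schur_eq_QL {n : ℕ} (lam : n.Partition) : schur lam = QL 0 (sortedParts lam) :=
  (QL_zero_eq_det _).symm

/-! ### Orthonormality and completeness of Schur functions -/

section Partitions

variable {n : ℕ}

theorem sortedParts_sorted (lam : n.Partition) : (sortedParts lam).SortedGE := by
  rw [sortedParts, List.sortedGE_reverse, List.sortedLE_iff_pairwise]
  exact Multiset.pairwise_sort _ _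

theorem coe_sortedParts (lam : n.Partition) : (sortedParts lam : Multiset ℕ) = lam.parts := by
  rw [sortedParts, Multiset.coe_reverse, Multiset.sort_eq]

theorem sum_sortedParts (lam : n.Partition) : (sortedParts lam).sum = n := by
  rw [← Multiset.sum_coe, coe_sortedParts, lam.parts_sum]

theorem pos_of_mem_sortedParts (lam : n.Partition) {a : ℕ} (ha : a ∈ sortedParts lam) : 0 < a := by
  rw [← Multiset.mem_coe, coe_sortedParts] at ha
  exact lam.parts_pos ha

theorem sortedParts_injective : Function.Injective (sortedParts (n := n)) := fun lam μ h => by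
  apply Nat.Partition.ext
  rw [← coe_sortedParts, h, coe_sortedParts]

theorem hProd_eq_hL (lam : n.Partition) : hProd lam = hL (sortedParts lam) := by
  rw [hProd, ← coe_sortedParts, Multiset.map_coe, Multiset.prod_coe, hL]

end Partitions

theorem sum_take_succ_getD (l : List ℕ) (p : ℕ) :
    (l.take (p + 1)).sum = (l.take p).sum + l.getD p 0 := by
  rcases lt_or_ge p l.length with h | h
  · rw [List.sum_take_succ _ _ h, List.getD_eq_getElem _ _ h]
  · rw [List.take_of_length_le h, List.take_of_length_le (by omega), List.getD_eq_default _ _ h]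
    rfl

theorem eq_of_getD_eq {l l' : List ℕ} (hl : ∀ a ∈ l, 0 < a) (hl' : ∀ a ∈ l', 0 < a)
    (h : ∀ p, l.getD p 0 = l'.getD p 0) : l = l' := by
  have key {l l' : List ℕ} (hl' : ∀ a ∈ l', 0 < a) (h : ∀ p, l.getD p 0 = l'.getD p 0) :
      l'.length ≤ l.length := by
    by_contra hlt
    push Not at hlt
    have h1 := h l.length
    rw [List.getD_eq_default _ _ le_rfl, List.getD_eq_getElem _ _ hlt] at h1
    have := hl' _ (List.getElem_mem hlt)
    omega
  refine List.ext_getElem (le_antisymm (key hl fun p => (h p).symm) (key hl' h)) fun p h1 h2 => ?_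
  rw [← List.getD_eq_getElem _ 0 h1, h, List.getD_eq_getElem]

theorem dominates_antisymm {n : ℕ} {lam μ : n.Partition} (h : dominates lam μ)
    (h' : dominates μ lam) : lam = μ := by
  refine sortedParts_injective (eq_of_getD_eq (fun _ => pos_of_mem_sortedParts _)
    (fun _ => pos_of_mem_sortedParts _) fun p => ?_)
  have h1 := le_antisymm (h p) (h' p)
  have h2 := le_antisymm (h (p + 1)) (h' (p + 1))
  rw [sum_take_succ_getD, sum_take_succ_getD] at h2
  omega

theorem dominates_trans {n : ℕ} {lam μ ν : n.Partition} (h : dominates lam μ)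
    (h' : dominates μ ν) : dominates lam ν := fun p => (h p).trans (h' p)

section Homogeneous

variable {n : ℕ}

theorem scal_homogeneous {f : SymF} (hf : f.IsWeightedHomogeneous (fun i => i + 1) n) (c : ℕ → K) :
    (scal c f).IsWeightedHomogeneous (fun i => i + 1) n := fun d hd => by
  rw [coeff_scal] at hd
  refine hf fun h => hd ?_
  rw [h]
  simp

theorem hL_homogeneous (κ : List ℕ) : (hL κ).IsWeightedHomogeneous (fun i => i + 1) κ.sum := by
  induction κ with
  | nil => simpa [hL] using isWeightedHomogeneous_one K (fun i : ℕ => i + 1)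
  | cons k κ ih =>
    rw [hL_cons, List.sum_cons]
    exact (hP_homogeneous k).mul ih

theorem schur_mem_span (lam : n.Partition) : schur lam ∈ Submodule.span K
    (hL '' (insert (sortedParts lam) (Above (sortedParts lam)))) := by
  have h := QL_sub_mem 0 (sortedParts lam)
  have h0 : qL (0 : K) = hL := funext qL_zero
  rw [h0, ← schur_eq_QL] at h
  rw [← sub_add_cancel (schur lam) (hL (sortedParts lam))]
  exact add_mem (Submodule.span_mono (Set.image_mono (Set.subset_insert _ _)) h)
    (Submodule.subset_span ⟨_, Set.mem_insert _ _, rfl⟩)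

theorem schur_homogeneous (lam : n.Partition) :
    (schur lam).IsWeightedHomogeneous (fun i => i + 1) n := by
  have h : Submodule.span K (hL '' (insert (sortedParts lam) (Above (sortedParts lam))))
      ≤ weightedHomogeneousSubmodule K (fun i : ℕ => i + 1) n := by
    rw [Submodule.span_le]
    rintro _ ⟨α, hα, rfl⟩
    have hs : α.sum = n := by
      rcases hα with rfl | hα
      · exact sum_sortedParts lam
      · exact hα.2.1.trans (sum_sortedParts lam)
    rw [SetLike.mem_coe, mem_weightedHomogeneousSubmodule]
    exact hs ▸ hL_homogeneous α
  exact h (schur_mem_span lam)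

/-- if `f` pairs nontrivially with `s_μ`, it does with some `h_α` with `α` above `μ` -/
theorem exists_hL_of_hall_schur {f : SymF} {μ : n.Partition} (h : hall f (schur μ) ≠ 0) :
    ∃ α ∈ insert (sortedParts μ) (Above (sortedParts μ)), hall f (hL α) ≠ 0 := by
  by_contra! hα
  have h1 : Submodule.span K (hL '' (insert (sortedParts μ) (Above (sortedParts μ))))
      ≤ LinearMap.ker (hallB f) := by
    rw [Submodule.span_le]
    rintro _ ⟨α, hα', rfl⟩
    exact hα α hα'
  exact h (h1 (schur_mem_span μ))

theorem dominates_of_hall_schur {f : SymF} {lam : n.Partition}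
    (hf : Bd (fun p => (((sortedParts lam).take p).sum : ℕ)) f)
    {μ : n.Partition} (h : hall f (schur μ) ≠ 0) : dominates μ lam := by
  obtain ⟨α, hα, hne⟩ := exists_hL_of_hall_schur h
  intro p
  have h1 : (α.take p).sum ≤ ((sortedParts lam).take p).sum := Int.ofNat_le.1 (hf α hne p)
  refine le_trans ?_ h1
  rcases hα with rfl | hα
  · exact le_rfl
  · exact hα.2.2.1 p

theorem hall_hL_of_above {f : SymF} {l : List ℕ} (hf : Bd (fun p => ((l.take p).sum : ℕ)) f)
    {α : List ℕ} (hα : α ∈ Above l) : hall f (hL α) = 0 := by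
  by_contra h
  refine hα.2.2.2 (eq_of_sum_take_eq hα.1 fun p => le_antisymm ?_ (hα.2.2.1 p))
  exact Int.ofNat_le.1 (hf α h p)

theorem hall_schur_self_of_Bd {f : SymF} {lam : n.Partition}
    (hf : Bd (fun p => (((sortedParts lam).take p).sum : ℕ)) f) :
    hall f (schur lam) = hall f (hL (sortedParts lam)) := by
  rw [hall_comm, schur_eq_QL, hall_QL_of_above, qL_zero, hall_comm]
  intro α hα
  rw [qL_zero, hall_comm]
  exact hall_hL_of_above hf hα

theorem Bd_schur (lam : n.Partition) :
    Bd (fun p => (((sortedParts lam).take p).sum : ℕ)) (schur lam) := by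
  rw [schur_eq_QL]
  exact Bd_QL 0 (sortedParts_sorted lam)

theorem hall_schur_schur (lam μ : n.Partition) [Decidable (lam = μ)] :
    hall (schur lam) (schur μ) = if lam = μ then 1 else 0 := by
  split_ifs with h
  · subst h
    rw [hall_schur_self_of_Bd (Bd_schur lam), schur_eq_QL, hall_QL_hL 0 (sortedParts_sorted lam)
      fun _ => pos_of_mem_sortedParts _, bL_zero]
  · by_contra hne
    exact h (dominates_antisymm
      (dominates_of_hall_schur (Bd_schur μ) (by rwa [hall_comm]))
      (dominates_of_hall_schur (Bd_schur lam) hne))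

theorem exists_expo_of_coeff_ne_zero {f : SymF} (hf : f.IsWeightedHomogeneous (fun i => i + 1) n)
    {d : ℕ →₀ ℕ} (hd : coeff d f ≠ 0) : ∃ ρ : n.Partition, expo ρ = d := by
  have h : wt d = n := hf hd
  obtain ⟨ρ, hρ⟩ := exists_expo_eq d
  subst h
  exact ⟨ρ, hρ⟩

theorem hall_eq_sum_partition {f : SymF} (hf : f.IsWeightedHomogeneous (fun i => i + 1) n)
    (g : SymF) : hall f g
      = ∑ ρ : n.Partition, coeff (expo ρ) f * coeff (expo ρ) g * zMon (expo ρ) := by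
  classical
  rw [hall_eq_sum f g (univ.map ⟨expo, expo_injective (n := n)⟩), Finset.sum_map]
  · rfl
  · intro d hd
    obtain ⟨ρ, rfl⟩ := exists_expo_of_coeff_ne_zero hf (mem_support_iff.1 hd)
    simp

theorem eq_sum_schur {f : SymF} (hf : f.IsWeightedHomogeneous (fun i => i + 1) n) :
    f = ∑ ν : n.Partition, hall f (schur ν) • schur ν := by
  classical
  set A : Matrix n.Partition n.Partition K := Matrix.of fun lam ρ => coeff (expo ρ) (schur lam)
  set Z : Matrix n.Partition n.Partition K := Matrix.diagonal fun ρ => zMon (expo ρ)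
  have h1 : A * (Z * A.transpose) = 1 := by
    ext lam μ
    rw [Matrix.one_apply, ← hall_schur_schur, hall_eq_sum_partition (schur_homogeneous lam),
      Matrix.mul_apply]
    refine Finset.sum_congr rfl fun ρ _ => ?_
    rw [Matrix.diagonal_mul, Matrix.transpose_apply]
    simp only [A, Matrix.of_apply]
    ring
  rw [mul_eq_one_comm] at h1
  ext d
  by_cases hd : ∃ ρ : n.Partition, expo ρ = d
  · obtain ⟨ρ, rfl⟩ := hd
    have h2 (σ : n.Partition) := congrFun (congrFun h1 σ) ρ
    rw [Matrix.mul_assoc] at h2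
    simp only [Z, Matrix.diagonal_mul] at h2
    simp only [Matrix.mul_apply, Matrix.transpose_apply, A, Matrix.of_apply, Matrix.one_apply] at h2
    simp only [coeff_sum, coeff_smul, hall_eq_sum_partition hf, smul_eq_mul, Finset.sum_mul]
    rw [Finset.sum_comm]
    have h3 (σ : n.Partition) : ∑ ν : n.Partition, coeff (expo σ) f * coeff (expo σ) (schur ν) *
        zMon (expo σ) * coeff (expo ρ) (schur ν) = coeff (expo σ) f * if σ = ρ then 1 else 0 := by
      rw [← h2, Finset.mul_sum, Finset.mul_sum]
      refine Finset.sum_congr rfl fun ν _ => ?_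
      ring
    simp [h3]
  · have h0 {g : SymF} (hg : g.IsWeightedHomogeneous (fun i => i + 1) n) : coeff d g = 0 := by
      by_contra h
      exact hd (exists_expo_of_coeff_ne_zero hg h)
    rw [h0 hf, coeff_sum]
    simp [h0 (schur_homogeneous _)]

end Homogeneous

/-! ### The involution `ω` and conjugation of partitions -/

/-- the involution `ω`, exchanging `h_m` and `e_m` -/
abbrev om : SymF →ₐ[K] SymF := scal fun i => (-1) ^ i

theorem om_om (f : SymF) : om (om f) = f := by
  rw [scal_scal]
  convert scal_one f using 3
  funext i
  rw [← mul_pow]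
  simp

theorem scal_pow_succ {n : ℕ} {f : SymF} (hf : f.IsWeightedHomogeneous (fun i => i + 1) n) (r : K) :
    scal (fun i => r ^ (i + 1)) f = r ^ n • f := by
  ext d
  rw [coeff_scal, coeff_smul, smul_eq_mul]
  by_cases hd : coeff d f = 0
  · rw [hd, mul_zero, mul_zero]
  · congr 1
    rw [← hf hd, Finsupp.weight_apply, Finsupp.prod, Finsupp.sum, ← Finset.prod_pow_eq_pow_sum]
    refine Finset.prod_congr rfl fun i _ => ?_
    rw [← pow_mul, smul_eq_mul, mul_comm]

theorem skew_om (k : ℕ) (f : SymF) :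
    skew (fun i => (-1) ^ i) k f = (-1 : K) ^ k • Dop k f := by
  refine eq_of_hall_eq _ _ fun u => ?_
  rw [hall_smul_right, ← hall_scal_hP_mul, ← hall_scal_hP_mul, ← hall_smul_left,
    ← smul_mul_assoc, ← map_smul, ← scal_pow_succ (hP_homogeneous k), scal_scal]
  congr 4
  funext i
  ring

theorem Lop_om_hZ (k : ℕ) (m : ℤ) :
    Lop k (om (hZ m)) = (if k = 0 then 1 else if k = 1 then 1 else 0 : K) • om (hZ (m - k)) := by
  have h : IsExpSeries (1 - PowerSeries.C (-1 : K) * PowerSeries.X) fun i => (-1 : K) ^ i * 1 := by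
    convert IsExpSeries.one_sub_mul_X (-1 : K) using 2
    ring
  rw [Lop, skew_scal_hZ h]
  congr 1
  rcases k with _ | _ | k
  · simp
  · simp
  · simp [PowerSeries.coeff_X, PowerSeries.coeff_one]

theorem Lop_zero (f : SymF) : Lop 0 f = f :=
  eq_of_hall_eq _ _ fun u => by rw [← hall_scal_hP_mul, hP_zero, map_one, one_mul]

theorem Lop_succ_om_hZ_mul (k : ℕ) (m : ℤ) (f : SymF) :
    Lop (k + 1) (om (hZ m) * f) = om (hZ m) * Lop (k + 1) f + om (hZ (m - 1)) * Lop k f := by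
  rw [Lop, skew_mul, Finset.Nat.sum_antidiagonal_succ, Finset.sum_eq_single (0, k)]
  · simp only [Lop_om_hZ]
    simp
  · intro ij hij hne
    rw [HasAntidiagonal.mem_antidiagonal] at hij
    have h1 : ij.1 ≠ 0 := fun h => hne (Prod.ext h (by simp only; omega))
    rw [Lop_om_hZ]
    simp [h1]
  · intro h
    exact absurd (HasAntidiagonal.mem_antidiagonal.2 (zero_add k)) h

theorem Bd.om_hZ_mul {w : ℕ → ℤ} {f : SymF} (h : Bd w f) (m : ℤ) :
    Bd (fun p => min (p : ℤ) m + w p) (om (hZ m) * f) := by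
  intro κ
  induction κ generalizing f w m with
  | nil =>
    intro hκ p
    have hf : f ≠ 0 := by
      rintro rfl
      simp [hall_zero_left] at hκ
    have hm : 0 ≤ m := by
      by_contra hm
      rw [hZ, if_pos (by omega)] at hκ
      simp [hall_zero_left] at hκ
    have := h.nonneg hf p
    simp
    omega
  | cons k κ ih =>
    intro hκ p
    have hf : f ≠ 0 := by
      rintro rfl
      simp [hall_zero_left] at hκ
    have hm : 0 ≤ m := by
      by_contra hm
      rw [hZ, if_pos (by omega)] at hκ
      simp [hall_zero_left] at hκ
    rcases p with _ | p
    · have := h.nonneg hf 0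
      simp
      omega
    · rw [List.take_succ_cons, List.sum_cons, Nat.cast_add]
      rw [hall_hL_cons] at hκ
      have key : hall (om (hZ m) * _root_.Lop k f) (hL κ) ≠ 0 ∨
          ∃ j, k = j + 1 ∧ hall (om (hZ (m - 1)) * _root_.Lop j f) (hL κ) ≠ 0 := by
        rcases k with _ | j
        · rw [Lop_zero] at hκ ⊢
          exact Or.inl hκ
        · by_contra! h0
          rw [Lop_succ_om_hZ_mul, hall_add_left, h0.1, h0.2 j rfl, add_zero] at hκ
          exact hκ rfl
      rcases key with hne | ⟨j, rfl, hne⟩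
      · have := ih (h.Lop k) m hne p
        simp only at this ⊢
        omega
      · have := ih (h.Lop j) (m - 1) hne p
        simp only at this ⊢
        omega

theorem Bd_om_hL (β : List ℕ) :
    Bd (fun p => ((β.map fun b => min p b).sum : ℕ)) (om (hL β)) := by
  induction β with
  | nil => simpa [hL] using Bd_one
  | cons b β ih =>
    have h := ih.om_hZ_mul b
    rw [hL_cons, map_mul]
    rw [hZ, if_neg (by omega), Int.toNat_natCast] at h
    refine h.mono fun p => ?_
    rw [List.map_cons, List.sum_cons, Nat.cast_add, Nat.cast_min]

theorem sum_min_eq (α : List ℕ) (p : ℕ) :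
    (α.map fun a => min p a).sum = ∑ j ∈ range p, α.countP fun a => j < a := by
  induction α with
  | nil => simp
  | cons a α ih =>
    simp only [List.map_cons, List.sum_cons, List.countP_cons, Finset.sum_add_distrib, ← ih]
    rw [add_comm]
    congr 1
    simp only [decide_eq_true_eq]
    rw [Finset.sum_boole, Nat.cast_id]
    have : (range p).filter (fun j => j < a) = range (min p a) := by
      ext j
      simp
    rw [this, card_range]

theorem sum_min_le (β : List ℕ) (p j : ℕ) :
    (β.map fun b => min p b).sum ≤ p * j + (β.drop j).sum := by
  induction β generalizing j with
  | nil => simp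
  | cons b β ih =>
    rcases j with _ | j
    · have := ih 0
      simp at this ⊢
      omega
    · have := ih j
      simp at this ⊢
      rw [mul_add]
      omega

theorem exists_sum_min_eq {α : List ℕ} (hα : α.SortedGE) (p : ℕ) :
    ∃ j, (α.map fun a => min p a).sum = p * j + (α.drop j).sum := by
  induction α with
  | nil => exact ⟨0, by simp⟩
  | cons a α ih =>
    have hα' := List.pairwise_cons.1 (List.sortedGE_iff_pairwise.1 hα)
    rcases le_or_gt p a with h | h
    · obtain ⟨j, hj⟩ := ih (List.sortedGE_iff_pairwise.2 hα'.2)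
      refine ⟨j + 1, ?_⟩
      rw [List.map_cons, List.sum_cons, hj, List.drop_succ_cons, min_eq_left h]
      ring
    · refine ⟨0, ?_⟩
      have : (a :: α).map (fun a => min p a) = (a :: α).map id := by
        refine List.map_congr_left fun b hb => min_eq_right ?_
        rcases List.mem_cons.1 hb with rfl | hb
        · exact h.le
        · exact (hα'.1 b hb).trans h.le
      rw [this]
      simp

theorem sum_min_le_of_le {α β : List ℕ} (hα : α.SortedGE) (hsum : β.sum = α.sum)
    (h : ∀ p, (α.take p).sum ≤ (β.take p).sum) (p : ℕ) :
    (β.map fun b => min p b).sum ≤ (α.map fun a => min p a).sum := by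
  obtain ⟨j, hj⟩ := exists_sum_min_eq hα p
  rw [hj]
  refine (sum_min_le β p j).trans ?_
  have h1 := List.sum_take_add_sum_drop α j
  have h2 := List.sum_take_add_sum_drop β j
  have := h j
  omega

theorem Dop_Hop_zero (a : ℤ) (k : ℕ) (f : SymF) :
    Dop (k + 1) (Hop 0 a f) = Hop 0 a (Dop (k + 1) f) - Hop 0 (a - 1) (Dop k f) := by
  rw [Dop, skew_Hop (Dop_qZ 0), Finset.Nat.sum_antidiagonal_succ, Finset.sum_eq_single (0, k)]
  · simp [sub_eq_add_neg]
  · intro ij hij hne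
    rw [HasAntidiagonal.mem_antidiagonal] at hij
    have h1 : ij.1 ≠ 0 := fun h => hne (Prod.ext h (by simp only; omega))
    simp [h1]
  · intro h
    exact absurd (HasAntidiagonal.mem_antidiagonal.2 (zero_add k)) h

theorem Dop_QL_eq_zero (α : List ℕ) (k : ℕ) (hk : α.length < k) : Dop k (QL 0 α) = 0 := by
  induction α generalizing k with
  | nil =>
    have : k ≠ 0 := by simp at hk; omega
    rw [QL, ← C_1, Dop, skew_C, if_neg this]
  | cons a α ih =>
    rcases k with _ | k
    · omega
    · rw [List.length_cons] at hk
      rw [QL, Dop_Hop_zero, ih _ (by omega), ih _ (by omega), map_zero, map_zero, sub_zero]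

theorem Dop_QL_length (α : List ℕ) (hα : ∀ a ∈ α, 0 < a) :
    Dop α.length (QL 0 α) = (-1 : K) ^ α.length • QL 0 (α.map fun a => a - 1) := by
  induction α with
  | nil =>
    rw [QL, ← C_1, Dop, skew_C]
    simp [QL]
  | cons a α ih =>
    have ha := hα a (by simp)
    rw [List.length_cons, QL, Dop_Hop_zero, Dop_QL_eq_zero _ _ (Nat.lt_succ_self _),
      ih fun b hb => hα b (by simp [hb]), map_zero, map_smul, List.map_cons, QL, pow_succ,
      Nat.cast_sub ha]
    simp

theorem QL_filter_pos {α : List ℕ} (hα : α.SortedGE) :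
    QL 0 (α.filter fun a => 0 < a) = QL 0 α := by
  induction α with
  | nil => rfl
  | cons a α ih =>
    have hα' := List.pairwise_cons.1 (List.sortedGE_iff_pairwise.1 hα)
    have ih := ih (List.sortedGE_iff_pairwise.2 hα'.2)
    rcases Nat.eq_zero_or_pos a with rfl | ha
    · have h0 : α.filter (fun a => 0 < a) = [] := by
        rw [List.filter_eq_nil_iff]
        intro b hb
        have := hα'.1 b hb
        simp
        omega
      rw [h0] at ih
      rw [QL, ← ih, QL, Nat.cast_zero, Hop_one, qZ_zero, List.filter_cons_of_neg (by simp), h0, QL]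
    · rw [List.filter_cons_of_pos (by simpa using ha), QL, QL, ih]

theorem hall_QL_om_hL (κ : List ℕ) {α : List ℕ} (hα : α.SortedGE)
    (h : ∀ j, (α.countP fun a => j < a) = κ.getD j 0) : hall (QL 0 α) (om (hL κ)) = 1 := by
  induction κ generalizing α with
  | nil =>
    have h0 : α.filter (fun a => 0 < a) = [] := by
      rw [← List.length_eq_zero_iff, ← List.countP_eq_length_filter, h 0]
      rfl
    rw [← QL_filter_pos hα, h0]
    simp [QL, hL, hall_one_left]
  | cons k κ ih =>
    set α' := α.filter fun a => 0 < a with hα'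
    have hlen : α'.length = k := by
      rw [hα', ← List.countP_eq_length_filter, h 0]
      rfl
    have hs' : α'.Pairwise (· ≥ ·) := (List.sortedGE_iff_pairwise.1 hα).filter _
    have hpos : ∀ a ∈ α', 0 < a := fun a ha => by simpa using (List.mem_filter.1 ha).2
    rw [hL_cons, map_mul, ← hall_skew, skew_om, ← QL_filter_pos hα, ← hα', ← hlen,
      Dop_QL_length _ hpos, smul_smul, ← mul_pow]
    simp only [neg_mul_neg, mul_one, one_pow, one_smul]
    refine ih ?_ fun j => ?_
    · rw [List.sortedGE_iff_pairwise, List.pairwise_map]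
      exact hs'.imp fun hab => Nat.sub_le_sub_right hab 1
    · have := h (j + 1)
      rw [List.getD_cons_succ] at this
      rw [← this, List.countP_map, hα', List.countP_filter]
      refine List.countP_congr fun a _ => ?_
      simp
      omega

theorem wellFounded_dominates {n : ℕ} :
    WellFounded fun μ lam : n.Partition => dominates μ lam ∧ μ ≠ lam := by
  have : IsTrans n.Partition fun μ lam => dominates μ lam ∧ μ ≠ lam :=
    ⟨fun a b c hab hbc => ⟨dominates_trans hab.1 hbc.1, by
      rintro rfl
      exact hab.2 (dominates_antisymm hab.1 hbc.1)⟩⟩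
  have : Std.Irrefl fun μ lam : n.Partition => dominates μ lam ∧ μ ≠ lam := ⟨fun a h => h.2 rfl⟩
  exact Finite.wellFounded_of_trans_of_irrefl _

theorem wellFounded_dominates_flip {n : ℕ} :
    WellFounded fun μ lam : n.Partition => dominates lam μ ∧ lam ≠ μ := by
  have : IsTrans n.Partition fun μ lam => dominates lam μ ∧ lam ≠ μ :=
    ⟨fun a b c hab hbc => ⟨dominates_trans hbc.1 hab.1, by
      rintro rfl
      exact hab.2 (dominates_antisymm hab.1 hbc.1)⟩⟩
  have : Std.Irrefl fun μ lam : n.Partition => dominates lam μ ∧ lam ≠ μ := ⟨fun a h => h.2 rfl⟩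
  exact Finite.wellFounded_of_trans_of_irrefl _

theorem om_schur_conj {n : ℕ} (conj : n.Partition → n.Partition)
    (hconj : ∀ (lam : n.Partition) (j : ℕ),
      Multiset.card ((conj lam).parts.filter fun m => j < m) = (sortedParts lam).getD j 0)
    (lam : n.Partition) : om (schur (conj lam)) = schur lam := by
  classical
  have hcount (lam : n.Partition) (j : ℕ) :
      ((sortedParts (conj lam)).countP fun a => j < a) = (sortedParts lam).getD j 0 := by
    rw [← hconj, ← coe_sortedParts (conj lam), Multiset.filter_coe, Multiset.coe_card,
      List.countP_eq_length_filter]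
  have hinj : Function.Injective conj := fun lam μ h => by
    refine sortedParts_injective (eq_of_getD_eq (fun _ => pos_of_mem_sortedParts _)
      (fun _ => pos_of_mem_sortedParts _) fun p => ?_)
    rw [← hcount, h, hcount]
  have hBd (lam : n.Partition) :
      Bd (fun p => (((sortedParts lam).take p).sum : ℕ)) (om (schur (conj lam))) := by
    intro κ hκ p
    rw [hall_scal, hall_comm] at hκ
    obtain ⟨β, hβ, hne⟩ := exists_hL_of_hall_schur hκ
    rw [hall_scal, hall_comm] at hne
    refine (Bd_om_hL β κ hne p).trans (Int.ofNat_le.2 ?_)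
    have hle : (β.map fun b => min p b).sum
        ≤ ((sortedParts (conj lam)).map fun a => min p a).sum := by
      rcases hβ with rfl | hβ
      · exact le_rfl
      · exact sum_min_le_of_le (sortedParts_sorted _) hβ.2.1 hβ.2.2.1 p
    refine hle.trans_eq ?_
    rw [sum_min_eq]
    simp only [hcount]
    clear hle hne hκ
    induction p with
    | zero => simp
    | succ p ih => rw [Finset.sum_range_succ, ih, sum_take_succ_getD]
  have horth (lam μ : n.Partition) (h : lam ≠ μ) :
      hall (om (schur (conj lam))) (om (schur (conj μ))) = 0 := by
    rw [hall_scal, om_om, hall_schur_schur, if_neg fun h' => h (hinj h')]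
  have hdiag (lam : n.Partition) : hall (om (schur (conj lam))) (schur lam) = 1 := by
    rw [hall_schur_self_of_Bd (hBd lam), hall_scal, schur_eq_QL]
    exact hall_QL_om_hL _ (sortedParts_sorted _) (hcount lam)
  induction lam using wellFounded_dominates.induction with
  | _ lam ih =>
    rw [eq_sum_schur (scal_homogeneous (schur_homogeneous (conj lam)) _),
      Finset.sum_eq_single lam, hdiag, one_smul]
    · intro μ _ hμ
      by_cases h : hall (om (schur (conj lam))) (schur μ) = 0
      · rw [h, zero_smul]
      · rw [← ih μ ⟨dominates_of_hall_schur (hBd lam) h, hμ⟩, horth _ _ hμ.symm, zero_smul]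
    · intro h
      exact absurd (mem_univ _) h

/-! ### Hall–Littlewood bases -/

theorem sum_le_sum_take {l : List ℕ} (hl : l.SortedGE) {s : Multiset ℕ} (hs : s ≤ l) {p : ℕ}
    (hp : s.card ≤ p) : s.sum ≤ (l.take p).sum := by
  induction l generalizing s p with
  | nil =>
    rw [Multiset.coe_nil, Multiset.le_zero] at hs
    simp [hs]
  | cons a l ih =>
    have hl' := List.pairwise_cons.1 (List.sortedGE_iff_pairwise.1 hl)
    have ih {s : Multiset ℕ} {p : ℕ} := @ih (List.sortedGE_iff_pairwise.2 hl'.2) s (p := p)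
    rw [← Multiset.cons_coe] at hs
    rcases p with _ | p
    · simp at hp
      simp [hp]
    · rw [List.take_succ_cons, List.sum_cons]
      by_cases ha : a ∈ s
      · obtain ⟨s, rfl⟩ := Multiset.exists_cons_of_mem ha
        rw [Multiset.cons_le_cons_iff] at hs
        rw [Multiset.card_cons] at hp
        rw [Multiset.sum_cons]
        exact Nat.add_le_add_left (ih hs (by omega)) a
      · exact (ih ((Multiset.le_cons_of_notMem ha).1 hs) hp).trans (sum_take_succ_le hl'.1 p)

theorem sum_filter_pos (l : List ℕ) : (l.filter fun a => 0 < a).sum = l.sum := by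
  induction l with
  | nil => rfl
  | cons a l ih =>
    rcases Nat.eq_zero_or_pos a with rfl | ha
    · rw [List.filter_cons_of_neg (by simp), ih, List.sum_cons, zero_add]
    · rw [List.filter_cons_of_pos (by simpa using ha), List.sum_cons, ih, List.sum_cons]

theorem hL_filter_pos (l : List ℕ) : hL (l.filter fun a => 0 < a) = hL l := by
  induction l with
  | nil => rfl
  | cons a l ih =>
    rcases Nat.eq_zero_or_pos a with rfl | ha
    · rw [List.filter_cons_of_neg (by simp), ih, hL_cons, hP_zero, one_mul]
    · rw [List.filter_cons_of_pos (by simpa using ha), hL_cons, ih, hL_cons]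

/-- every composition of `n` rearranges to a partition of `n` dominating it -/
theorem exists_partition_hL {n : ℕ} {κ : List ℕ} (h : κ.sum = n) :
    ∃ μ : n.Partition, hProd μ = hL κ ∧ ∀ p, (κ.take p).sum ≤ ((sortedParts μ).take p).sum := by
  let μ : n.Partition := ⟨(κ.filter fun a => 0 < a : List ℕ), fun {i} hi => by
    simpa using (List.mem_filter.1 (Multiset.mem_coe.1 hi)).2, by
    rw [Multiset.sum_coe, sum_filter_pos, h]⟩
  refine ⟨μ, ?_, fun p => ?_⟩
  · rw [← hL_filter_pos]
    simp only [hProd, μ, Multiset.map_coe, Multiset.prod_coe]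
    rfl
  · rw [← sum_filter_pos (κ.take p), ← Multiset.sum_coe]
    refine sum_le_sum_take (sortedParts_sorted μ) ?_ ?_
    · rw [coe_sortedParts]
      exact Multiset.coe_le.2 ((List.take_sublist p κ).filter _).subperm
    · rw [Multiset.coe_card]
      exact (List.length_filter_le _ _).trans (List.length_take_le p κ)

theorem hall_eq_zero_of_degree {m n : ℕ} {f g : SymF}
    (hf : f.IsWeightedHomogeneous (fun i => i + 1) m)
    (hg : g.IsWeightedHomogeneous (fun i => i + 1) n) (h : n ≠ m) : hall f g = 0 := by
  refine Finset.sum_eq_zero fun d hd => ?_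
  have h1 := hf (mem_support_iff.1 hd)
  have h2 : coeff d g = 0 := by
    by_contra h3
    exact h ((hg h3).symm.trans h1)
  rw [h2, mul_zero, zero_mul]

theorem qL_homogeneous (t : K) (α : List ℕ) :
    (qL t α).IsWeightedHomogeneous (fun i => i + 1) α.sum := by
  induction α with
  | nil => simpa [qL] using isWeightedHomogeneous_one K (fun i : ℕ => i + 1)
  | cons k α ih =>
    rw [qL_cons, List.sum_cons, qZ_natCast]
    exact (scal_homogeneous (hP_homogeneous k) _).mul ih

theorem QL_homogeneous (t : K) (l : List ℕ) :
    (QL t l).IsWeightedHomogeneous (fun i => i + 1) l.sum := by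
  have h : Submodule.span K (qL t '' Above l)
      ≤ weightedHomogeneousSubmodule K (fun i : ℕ => i + 1) l.sum := by
    rw [Submodule.span_le]
    rintro _ ⟨α, hα, rfl⟩
    rw [SetLike.mem_coe, mem_weightedHomogeneousSubmodule]
    exact hα.2.1 ▸ qL_homogeneous t α
  have h1 := h (QL_sub_mem t l)
  rw [← sub_add_cancel (QL t l) (qL t l)]
  exact ((mem_weightedHomogeneousSubmodule _ _ _ _).1 h1).add (qL_homogeneous t l)

theorem one_sub_q_pow_ne_zero (i : ℕ) : (1 : K) - q ^ (i + 1) ≠ 0 := by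
  intro h
  have h1 : (algebraMap (Polynomial ℚ) K) (1 - Polynomial.X ^ (i + 1)) = 0 := by
    simpa [q, RatFunc.algebraMap_X] using h
  rw [map_eq_zero_iff _ (RatFunc.algebraMap_injective ℚ)] at h1
  have h2 := congrArg (Polynomial.eval 0) h1
  simp at h2

theorem hallT_eq (f g : SymF) : hallT f g = hall (mulY f) g := by
  rw [show mulY = scal fun i => (1 - q ^ (i + 1))⁻¹ from rfl,
    hall_eq_sum _ g f.support]
  · refine Finset.sum_congr rfl fun d _ => ?_
    rw [coeff_scal, zMonT, Finsupp.prod]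
    ring
  · intro d hd
    rw [mem_support_iff, coeff_scal] at hd
    exact mem_support_iff.2 (right_ne_zero_of_mul hd)

theorem mulY_qL (α : List ℕ) : mulY (qL q α) = hL α := by
  rw [show mulY = scal fun i => (1 - q ^ (i + 1))⁻¹ from rfl, qL, hL, map_list_prod, List.map_map]
  congr 1
  refine List.map_congr_left fun a _ => ?_
  rw [Function.comp_apply, qZ_natCast, scal_scal]
  convert scal_one (hP a) using 3
  funext i
  exact inv_mul_cancel₀ (one_sub_q_pow_ne_zero i)

namespace IsHLBasis

variable {n : ℕ} {P : n.Partition → SymF}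

theorem bd (hP : IsHLBasis n P) (lam : n.Partition) :
    Bd (fun p => (((sortedParts lam).take p).sum : ℕ)) (P lam) := by
  intro κ hκ p
  have hs : κ.sum = n := by
    by_contra h
    exact hκ (hall_eq_zero_of_degree (hP.homog lam) (hL_homogeneous κ) h)
  obtain ⟨μ, hμ, hle⟩ := exists_partition_hL hs
  rw [← hμ] at hκ
  exact Int.ofNat_le.2 ((hle p).trans (hP.triangular lam μ hκ p))

variable {Kst : n.Partition → n.Partition → K}

theorem hall_schur_hProd
    (hKst : ∀ μ : n.Partition, schur μ = ∑ lam : n.Partition, Kst μ lam • P lam)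
    (μ : n.Partition) (g : SymF) : hall (schur μ) g = ∑ lam, Kst μ lam * hall (P lam) g := by
  rw [hKst, hall_sum_left]
  simp only [hall_smul_left]

theorem dominates_of_Kst_ne_zero (hP : IsHLBasis n P)
    (hKst : ∀ μ : n.Partition, schur μ = ∑ lam : n.Partition, Kst μ lam • P lam)
    {μ τ : n.Partition} (h : Kst μ τ ≠ 0) : dominates τ μ := by
  induction τ using wellFounded_dominates_flip.induction with
  | _ τ ih =>
    by_cases hex : ∃ lam, (dominates τ lam ∧ τ ≠ lam) ∧ Kst μ lam ≠ 0
    · obtain ⟨lam, h1, h2⟩ := hex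
      exact dominates_trans h1.1 (ih lam h1 h2)
    · have h1 := hall_schur_hProd hKst μ (hProd τ)
      rw [Finset.sum_eq_single τ, hP.diag, mul_one] at h1
      · intro p
        refine Int.ofNat_le.1 (Bd_schur μ (sortedParts τ) ?_ p)
        rwa [← hProd_eq_hL, h1]
      · intro lam _ hne
        by_contra h2
        exact hex ⟨lam, ⟨hP.triangular _ _ (right_ne_zero_of_mul h2), hne.symm⟩,
          left_ne_zero_of_mul h2⟩
      · intro h2
        exact absurd (mem_univ _) h2

theorem Kst_self (hP : IsHLBasis n P)
    (hKst : ∀ μ : n.Partition, schur μ = ∑ lam : n.Partition, Kst μ lam • P lam)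
    (μ : n.Partition) : Kst μ μ = 1 := by
  classical
  have h1 := hall_schur_hProd hKst μ (hProd μ)
  rw [Finset.sum_eq_single μ, hP.diag, mul_one, hProd_eq_hL,
    ← hall_schur_self_of_Bd (Bd_schur μ), hall_schur_schur, if_pos rfl] at h1
  · exact h1.symm
  · intro lam _ hne
    by_contra h2
    exact hne (dominates_antisymm (hP.dominates_of_Kst_ne_zero hKst (left_ne_zero_of_mul h2))
      (hP.triangular _ _ (right_ne_zero_of_mul h2)))
  · intro h2
    exact absurd (mem_univ _) h2

theorem hallT_schur_left (hP : IsHLBasis n P)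
    (hKst : ∀ μ : n.Partition, schur μ = ∑ lam : n.Partition, Kst μ lam • P lam)
    (μ τ : n.Partition) : hallT (schur μ) (P τ) = Kst μ τ * hallT (P τ) (P τ) := by
  rw [hKst, hallT_eq, map_sum, hall_sum_left, Finset.sum_eq_single τ]
  · rw [map_smul, hall_smul_left, hallT_eq]
  · intro lam _ hne
    rw [map_smul, hall_smul_left, ← hallT_eq, hP.orth _ _ hne, mul_zero]
  · intro h2
    exact absurd (mem_univ _) h2

theorem hallT_schur_schur (hP : IsHLBasis n P)
    (hKst : ∀ μ : n.Partition, schur μ = ∑ lam : n.Partition, Kst μ lam • P lam)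
    (μ ν : n.Partition) : hallT (schur μ) (schur ν)
      = ∑ τ, Kst μ τ * Kst ν τ * hallT (P τ) (P τ) := by
  rw [hKst ν, hallT_eq, hall_sum_right]
  refine Finset.sum_congr rfl fun τ _ => ?_
  rw [hall_smul_right, ← hallT_eq, hP.hallT_schur_left hKst]
  ring

theorem bL_mul_hallT_self (hP : IsHLBasis n P)
    (hKst : ∀ μ : n.Partition, schur μ = ∑ lam : n.Partition, Kst μ lam • P lam)
    (lam : n.Partition) : bL q (sortedParts lam) * hallT (P lam) (P lam) = 1 := by
  have hQ : Bd (fun p => (((sortedParts lam).take p).sum : ℕ)) (QL q (sortedParts lam)) :=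
    Bd_QL q (sortedParts_sorted lam)
  have h1 : hallT (QL q (sortedParts lam)) (P lam) = 1 := by
    have hq (α : List ℕ) : hall (qL q α) (mulY (P lam)) = hall (P lam) (hL α) := by
      rw [← mulY_qL, hall_comm (P lam)]
      exact (hall_scal _ _ _).symm
    rw [hallT_eq]
    refine (hall_scal _ _ _).trans ?_
    change hall _ (mulY (P lam)) = 1
    rw [hall_QL_of_above, hq, ← hProd_eq_hL, hP.diag]
    intro α hα
    rw [hq, hall_hL_of_above (hP.bd lam) hα]
  have hQh : (QL q (sortedParts lam)).IsWeightedHomogeneous (fun i => i + 1) n := by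
    have := QL_homogeneous q (sortedParts lam)
    rwa [sum_sortedParts] at this
  rw [eq_sum_schur hQh, hallT_eq, map_sum, hall_sum_left, Finset.sum_eq_single lam] at h1
  · rwa [map_smul, hall_smul_left, ← hallT_eq, hP.hallT_schur_left hKst, hP.Kst_self hKst, one_mul,
      hall_schur_self_of_Bd hQ, hall_QL_hL q (sortedParts_sorted lam)
        fun _ => pos_of_mem_sortedParts _] at h1
  · intro κ _ hne
    rw [map_smul, hall_smul_left, ← hallT_eq, hP.hallT_schur_left hKst]
    by_contra h2
    exact hne (dominates_antisymm (dominates_of_hall_schur hQ (left_ne_zero_of_mul h2))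
      (hP.dominates_of_Kst_ne_zero hKst (left_ne_zero_of_mul (right_ne_zero_of_mul h2))))
  · intro h2
    exact absurd (mem_univ _) h2

end IsHLBasis

/-! ### Inversion of `q` -/

theorem bL_eq_prod (t : K) {l : List ℕ} {s : Finset ℕ} (hs : ∀ a ∈ l, a ∈ s) :
    bL t l = ∏ i ∈ s, ∏ k ∈ range (l.count i), (1 - t ^ (k + 1)) := by
  induction l with
  | nil => simp [bL]
  | cons m l ih =>
    rw [bL, ih fun a ha => hs a (by simp [ha]),
      ← Finset.mul_prod_erase s _ (hs m (by simp)), ← Finset.mul_prod_erase s _ (hs m (by simp)),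
      List.count_cons_self, Finset.prod_range_succ, ← mul_assoc, mul_comm (1 - _)]
    congr 1
    refine Finset.prod_congr rfl fun i hi => ?_
    rw [List.count_cons_of_ne (Finset.ne_of_mem_erase hi).symm]

theorem aP_eq {n : ℕ} (invq : K →+* K) (hinvq : invq q = q⁻¹) (lam : n.Partition) :
    aP lam = q ^ (n + 2 * nStat lam) * invq (bL q (sortedParts lam)) := by
  rw [aP, bL_eq_prod q (s := lam.parts.toFinset)]
  · rw [map_prod]
    congr 1
    refine Finset.prod_congr rfl fun i _ => ?_
    rw [map_prod, ← Multiset.coe_count, coe_sortedParts]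
    refine Finset.prod_congr rfl fun k _ => ?_
    rw [map_sub, map_one, map_pow, hinvq]
  · intro a ha
    rw [Multiset.mem_toFinset, ← coe_sortedParts]
    exact ha

theorem map_schur (φ : K →+* K) {n : ℕ} (lam : n.Partition) :
    MvPolynomial.map φ (schur lam) = schur lam := by
  have hp (m : ℕ) : MvPolynomial.map φ (hP m) = hP m := by
    simp only [hP, map_sum, pP_eq_monomial, smul_monomial, map_monomial, smul_eq_mul, mul_one,
      map_inv₀, map_natCast]
  have hz (m : ℤ) : MvPolynomial.map φ (hZ m) = hZ m := by
    rw [hZ]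
    split_ifs
    · exact map_zero _
    · exact hp _
  rw [schur, RingHom.map_det]
  congr 1
  ext1 i j
  exact hz _

theorem map_hall_scal (φ : K →+* K) (c : ℕ → K) {f g : SymF} (hf : MvPolynomial.map φ f = f)
    (hg : MvPolynomial.map φ g = g) :
    φ (hall (scal c f) g) = hall (scal (fun i => φ (c i)) f) g := by
  have hsub (c : ℕ → K) : (scal c f).support ⊆ f.support := fun d hd => by
    rw [mem_support_iff, coeff_scal] at hd
    exact mem_support_iff.2 (right_ne_zero_of_mul hd)
  have hcoeff {f : SymF} (hf : MvPolynomial.map φ f = f) (d : ℕ →₀ ℕ) :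
      φ (coeff d f) = coeff d f := by
    rw [← coeff_map, hf]
  rw [hall_eq_sum _ g _ (hsub _), hall_eq_sum _ g _ (hsub _), map_sum]
  refine Finset.sum_congr rfl fun d _ => ?_
  simp only [coeff_scal, map_mul, hcoeff hf, hcoeff hg, zMon, map_prod, map_natCast, Finsupp.prod,
    map_pow]

theorem q_ne_zero : q ≠ 0 := RatFunc.X_ne_zero

theorem map_hallT_schur (invq : K →+* K) (hinvq : invq q = q⁻¹) {n : ℕ} (μ ν : n.Partition) :
    invq (hallT (schur μ) (schur ν)) = (-q) ^ n * hall (mulY (om (schur μ))) (schur ν) := by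
  rw [hallT_eq, show mulY = scal fun i => (1 - q ^ (i + 1))⁻¹ from rfl,
    map_hall_scal invq _ (map_schur _ _) (map_schur _ _), ← hall_smul_left, ← map_smul, ← map_smul,
    ← scal_pow_succ (schur_homogeneous μ), scal_scal, scal_scal]
  congr 3
  funext i
  rw [map_inv₀, map_sub, map_one, map_pow, hinvq, mul_assoc]
  have h1 := one_sub_q_pow_ne_zero i
  have h2 : (1 : K) - q⁻¹ ^ (i + 1) = - (1 - q ^ (i + 1)) * (q ^ (i + 1))⁻¹ := by
    have := pow_ne_zero (i + 1) q_ne_zero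
    rw [inv_pow]
    field_simp
    ring
  have h3 : (-1 : K) ^ i * (-q) ^ (i + 1) = - q ^ (i + 1) := by
    rw [neg_pow q, ← mul_assoc, ← pow_add, ← add_assoc, pow_succ, ← two_mul, pow_mul]
    simp
  rw [h3, h2, mul_inv, inv_inv, inv_neg]
  ring

open Classical in
theorem schur_conj_product_alphabet (n : ℕ)
    (P : n.Partition → SymF) (hP : IsHLBasis n P)
    (Kst : n.Partition → n.Partition → K)
    (hKst : ∀ μ : n.Partition, schur μ = ∑ lam : n.Partition, Kst μ lam • P lam)
    (invq : K →+* K) (hinvq : invq RatFunc.X = (RatFunc.X)⁻¹)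
    -- the conjugation (transposition) of partitions:
    (conj : n.Partition → n.Partition)
    (hconj : ∀ (lam : n.Partition) (j : ℕ),
      Multiset.card ((conj lam).parts.filter fun m => j < m) = (sortedParts lam).getD j 0)
    (μ : n.Partition) :
    mulY (schur (conj μ))
      = ((-1 : K) ^ n) •
          ∑ τ ∈ Finset.univ.filter (fun τ : n.Partition => dominates τ μ),
            (HsH τ * Ktilde Kst invq μ τ) • Htilde Kst invq τ := by
  have hq : invq q = q⁻¹ := hinvq
  have hcoef (τ ν : n.Partition) : HsH τ * Ktilde Kst invq μ τ * Ktilde Kst invq ν τ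
      = (q ^ n)⁻¹ * invq (Kst μ τ * Kst ν τ * hallT (P τ) (P τ)) := by
    have h1 := hP.bL_mul_hallT_self hKst τ
    have h2 : invq (hallT (P τ) (P τ)) = (invq (bL q (sortedParts τ)))⁻¹ := by
      rw [eq_comm, inv_eq_iff_eq_inv, ← map_inv₀, eq_inv_of_mul_eq_one_left h1]
    have h3 := pow_ne_zero (nStat τ) q_ne_zero
    rw [HsH, aP_eq invq hq, Ktilde, Ktilde, map_mul, map_mul, h2, mul_inv, pow_add, mul_inv,
      two_mul, pow_add, mul_inv]
    field_simp
  have hfull : ∑ τ ∈ Finset.univ.filter (fun τ : n.Partition => dominates τ μ),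
      (HsH τ * Ktilde Kst invq μ τ) • Htilde Kst invq τ
        = ∑ τ, (HsH τ * Ktilde Kst invq μ τ) • Htilde Kst invq τ := by
    refine Finset.sum_filter_of_ne fun τ _ hne => hP.dominates_of_Kst_ne_zero hKst fun h0 => ?_
    rw [Ktilde, h0, map_zero, mul_zero, mul_zero, zero_smul] at hne
    exact hne rfl
  have hmulY : (mulY (om (schur μ))).IsWeightedHomogeneous (fun i => i + 1) n :=
    scal_homogeneous (scal_homogeneous (schur_homogeneous μ) _) _
  rw [hfull, ← om_om (schur (conj μ)), om_schur_conj conj hconj, eq_sum_schur hmulY]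
  simp only [Htilde, Finset.smul_sum, smul_smul, hcoef]
  rw [Finset.sum_comm]
  refine Finset.sum_congr rfl fun ν _ => ?_
  rw [← Finset.sum_smul, ← Finset.mul_sum, ← Finset.mul_sum, ← map_sum,
    ← hP.hallT_schur_schur hKst, map_hallT_schur invq hq]
  congr 1
  have h4 := pow_ne_zero n q_ne_zero
  rw [neg_pow q]
  field_simp
  rw [← pow_mul, mul_comm n, pow_mul]
  simp
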